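/- arXiv:2504.14673 — 3 statements merged into one kernel-verified Lean document; each statement's English description precedes it below -/
import Mathlib

section
/- The SOS hierarchy values converge to the Gromov–Wasserstein value: gw^{(r)}(μ,ν) → gw(μ,ν) as r → ∞. -/
open MeasureTheory Metric Filter Set

namespace GWSOS

variable {X Y : Type*}

/-- The set of couplings of `μ` and `ν`. -/
def Couplings [MeasurableSpace X] [MeasurableSpace Y] (μ : Measure X) (ν : Measure Y) :
    Set (Measure (X × Y)) :=
  {π | IsProbabilityMeasure π ∧ π.map Prod.fst = μ ∧ π.map Prod.snd = ν}

/-- The Gromov–Wasserstein value for cost `c`. -/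
noncomputable def gwVal [MeasurableSpace X] [MeasurableSpace Y]
    (c : X × Y → X × Y → ℝ) (μ : Measure X) (ν : Measure Y) : ℝ :=
  ⨅ π : Couplings μ ν,
    ∫ z, c z.1 z.2 ∂((π : Measure (X × Y)).prod (π : Measure (X × Y)))

/-- (Sym): invariance under permutation of the `2r` coordinate pairs. -/
def SymCond [MeasurableSpace X] [MeasurableSpace Y] (r : ℕ)
    (P : Measure (Fin (2 * r) → X × Y)) : Prop :=
  ∀ σ : Equiv.Perm (Fin (2 * r)), P.map (fun z => z ∘ σ) = P

/-- (Mar): marginal conditions. -/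
def MarCond [MeasurableSpace X] [MeasurableSpace Y] (r : ℕ)
    (μ : Measure X) (ν : Measure Y) (P : Measure (Fin (2 * r) → X × Y)) : Prop :=
  ∀ i : Fin (2 * r),
    P.map (fun z => ((z i).1, fun j : {j : Fin (2 * r) // j ≠ i} => z j.1))
      = μ.prod (P.map (fun z (j : {j : Fin (2 * r) // j ≠ i}) => z j.1)) ∧
    P.map (fun z => ((z i).2, fun j : {j : Fin (2 * r) // j ≠ i} => z j.1))
      = ν.prod (P.map (fun z (j : {j : Fin (2 * r) // j ≠ i}) => z j.1))

/-- (PSD+): the positive semidefiniteness condition. -/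
def PSDCond [MeasurableSpace X] [MeasurableSpace Y] (r : ℕ)
    (P : Measure (Fin (2 * r) → X × Y)) : Prop :=
  ∀ (t : ℕ) (ht : t ≤ r) (f : (Fin t → X × Y) → ℝ) (g : (Fin (2 * r - 2 * t) → X × Y) → ℝ),
    Measurable f → (∃ M, ∀ w, |f w| ≤ M) →
    Measurable g → (∃ M, ∀ w, |g w| ≤ M) → (∀ w, 0 ≤ g w) →
    0 ≤ ∫ z, (f fun s => z ⟨s.1, by have := s.isLt; omega⟩)
          * (f fun s => z ⟨t + s.1, by have := s.isLt; omega⟩)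
          * (g fun s => z ⟨2 * t + s.1, by have := s.isLt; omega⟩) ∂P

/-- The feasible set `Π_r(μ,ν)` of the level-`r` relaxation. -/
def PiRSet [MeasurableSpace X] [MeasurableSpace Y] (r : ℕ)
    (μ : Measure X) (ν : Measure Y) : Set (Measure (Fin (2 * r) → X × Y)) :=
  {P | IsProbabilityMeasure P ∧ SymCond r P ∧ MarCond r μ ν P ∧ PSDCond r P}

/-- The level-`r` SOS value `gw^{(r)}(μ,ν)`. -/
noncomputable def gwRVal [MeasurableSpace X] [MeasurableSpace Y] (r : ℕ) (hr : 0 < r)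
    (c : X × Y → X × Y → ℝ) (μ : Measure X) (ν : Measure Y) : ℝ :=
  ⨅ P : PiRSet r μ ν,
    ∫ z, c (z ⟨0, by omega⟩) (z ⟨1, by omega⟩) ∂(P : Measure (Fin (2 * r) → X × Y))

/-- `c` is Lipschitz with constant `C` for the sum metric. -/
def LipCost [PseudoMetricSpace X] [PseudoMetricSpace Y] (C : ℝ)
    (c : X × Y → X × Y → ℝ) : Prop :=
  ∀ z₁ z₂ w₁ w₂ : X × Y,
    |c z₁ z₂ - c w₁ w₂|
      ≤ C * (dist z₁.1 w₁.1 + dist z₁.2 w₁.2 + dist z₂.1 w₂.1 + dist z₂.2 w₂.2)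

/-- The `L^{p,q}` distortion cost. -/
noncomputable def distCost [PseudoMetricSpace X] [PseudoMetricSpace Y] (p q : ℝ)
    (z w : X × Y) : ℝ :=
  |dist z.1 w.1 ^ q - dist z.2 w.2 ^ q| ^ p

end GWSOS

open ProbabilityTheory

namespace GWSOS

section Conditioning

variable {Ω Z : Type*} [MeasurableSpace Ω] [MeasurableSpace Z]

/-- The block `(ζ 1, …, ζ k)` of the sequence `ζ`. -/
def block (ζ : ℕ → Ω → Z) (k : ℕ) (ω : Ω) : Fin k → Z := fun s => ζ (s + 1) ω

lemma measurable_block {ζ : ℕ → Ω → Z} (hζ : ∀ i, Measurable (ζ i)) (k : ℕ) :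
    Measurable (block ζ k) :=
  measurable_pi_lambda _ fun _ => hζ _

variable [StandardBorelSpace Z] [Nonempty Z]

/-- The conditional law of `ζ 0` given `(ζ 1, …, ζ k)`. -/
noncomputable def blockKernel (P : Measure Ω) [IsFiniteMeasure P] (ζ : ℕ → Ω → Z) (k : ℕ) :
    Kernel (Fin k → Z) Z :=
  condDistrib (ζ 0) (block ζ k) P

instance (P : Measure Ω) [IsFiniteMeasure P] (ζ : ℕ → Ω → Z) (k : ℕ) :
    IsMarkovKernel (blockKernel P ζ k) := by
  unfold blockKernel; infer_instance

/-- The conditional expectation of `φ (ζ 0)` given `(ζ 1, …, ζ k)`, as a function of the block. -/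
noncomputable def blockMean (P : Measure Ω) [IsFiniteMeasure P] (ζ : ℕ → Ω → Z) (φ : Z → ℝ)
    (k : ℕ) (w : Fin k → Z) : ℝ :=
  ∫ z, φ z ∂blockKernel P ζ k w

variable {P : Measure Ω} [IsProbabilityMeasure P] {ζ : ℕ → Ω → Z} {φ ψ : Z → ℝ} {A B : ℝ}

lemma integrable_of_measurable_of_bounded {α : Type*} [MeasurableSpace α] {m : Measure α}
    [IsFiniteMeasure m] {f : α → ℝ} (hf : Measurable f) {A : ℝ} (hA : ∀ x, |f x| ≤ A) :
    Integrable f m :=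
  .of_bound hf.aestronglyMeasurable A (.of_forall hA)

lemma abs_integral_le_of_bounded {α : Type*} [MeasurableSpace α] {m : Measure α}
    [IsProbabilityMeasure m] {f : α → ℝ} {A : ℝ} (hA : ∀ x, |f x| ≤ A) :
    |∫ x, f x ∂m| ≤ A := by
  simpa using norm_integral_le_of_norm_le_const (μ := m) (f := f) (.of_forall hA)

lemma abs_mul_le_of_bounded {a b A B : ℝ} (ha : |a| ≤ A) (hb : |b| ≤ B) : |a * b| ≤ A * B := by
  rw [abs_mul]
  exact mul_le_mul ha hb (abs_nonneg _) ((abs_nonneg _).trans ha)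

lemma integrable_mul_of_bounded {α : Type*} [MeasurableSpace α] {m : Measure α}
    [IsFiniteMeasure m] {f g : α → ℝ} (hf : Measurable f) (hg : Measurable g) {A B : ℝ}
    (hA : ∀ x, |f x| ≤ A) (hB : ∀ x, |g x| ≤ B) : Integrable (fun x => f x * g x) m :=
  integrable_of_measurable_of_bounded (hf.mul hg) fun x => abs_mul_le_of_bounded (hA x) (hB x)

lemma measurable_blockMean (hφ : Measurable φ) (k : ℕ) : Measurable (blockMean P ζ φ k) :=
  (StronglyMeasurable.integral_kernel hφ.stronglyMeasurable).measurable

lemma abs_blockMean_le (hA : ∀ z, |φ z| ≤ A) (k : ℕ) (w : Fin k → Z) :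
    |blockMean P ζ φ k w| ≤ A :=
  abs_integral_le_of_bounded hA

lemma integral_mul_block (hζ : ∀ i, Measurable (ζ i)) (hφ : Measurable φ)
    (hA : ∀ z, |φ z| ≤ A) {k : ℕ} {g : (Fin k → Z) → ℝ} (hg : Measurable g)
    (hB : ∀ w, |g w| ≤ B) :
    ∫ ω, φ (ζ 0 ω) * g (block ζ k ω) ∂P
      = ∫ ω, blockMean P ζ φ k (block ζ k ω) * g (block ζ k ω) ∂P := by
  have hm := measurable_block hζ k
  have hh : Measurable fun p : (Fin k → Z) × Z => φ p.2 * g p.1 := by fun_prop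
  calc ∫ ω, φ (ζ 0 ω) * g (block ζ k ω) ∂P
      = ∫ p, φ p.2 * g p.1 ∂(P.map fun ω => (block ζ k ω, ζ 0 ω)) := by
        rw [integral_map (hm.prodMk (hζ 0)).aemeasurable hh.aestronglyMeasurable]
    _ = ∫ p, φ p.2 * g p.1 ∂((P.map (block ζ k)) ⊗ₘ blockKernel P ζ k) := by
        rw [blockKernel, compProd_map_condDistrib (hζ 0).aemeasurable]
    _ = ∫ w, blockMean P ζ φ k w * g w ∂(P.map (block ζ k)) := by
        have : IsProbabilityMeasure (P.map (block ζ k)) :=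
          Measure.isProbabilityMeasure_map hm.aemeasurable
        rw [Measure.integral_compProd (integrable_of_measurable_of_bounded hh
          fun p => abs_mul_le_of_bounded (hA _) (hB _))]
        simp only [integral_mul_const, blockMean]
    _ = _ := by
        have hF : Measurable fun w => blockMean P ζ φ k w * g w :=
          (measurable_blockMean hφ k).mul hg
        rw [integral_map hm.aemeasurable hF.aestronglyMeasurable]

lemma integral_sq_sub_blockMean (hζ : ∀ i, Measurable (ζ i)) (hφ : Measurable φ)
    (hA : ∀ z, |φ z| ≤ A) (k : ℕ) :
    ∫ ω, (blockMean P ζ φ (k + 1) (block ζ (k + 1) ω) - blockMean P ζ φ k (block ζ k ω)) ^ 2 ∂P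
      = ∫ ω, blockMean P ζ φ (k + 1) (block ζ (k + 1) ω) ^ 2 ∂P
        - ∫ ω, blockMean P ζ φ k (block ζ k ω) ^ 2 ∂P := by
  have h₁ := integral_mul_block (P := P) hζ hφ hA (measurable_blockMean (P := P) (ζ := ζ) hφ k)
    (abs_blockMean_le hA k)
  have hr : Measurable fun w : Fin (k + 1) → Z => fun s : Fin k => w s.castSucc := by fun_prop
  have h₂ := integral_mul_block (P := P) hζ hφ hA (k := k + 1)
    ((measurable_blockMean (P := P) (ζ := ζ) hφ k).comp hr)
    (fun w => abs_blockMean_le hA k _)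
  have hb : ∀ ω, (fun s : Fin k => block ζ (k + 1) ω s.castSucc) = block ζ k ω := fun ω => rfl
  simp only [Function.comp_def, hb] at h₂
  have hM := (measurable_blockMean (P := P) (ζ := ζ) hφ k).comp (measurable_block hζ k)
  have hN := (measurable_blockMean (P := P) (ζ := ζ) hφ (k + 1)).comp
    (measurable_block hζ (k + 1))
  simp only [Function.comp_def] at hM hN
  have bM : ∀ ω, |blockMean P ζ φ k (block ζ k ω)| ≤ A := fun ω => abs_blockMean_le hA k _
  have bN : ∀ ω, |blockMean P ζ φ (k + 1) (block ζ (k + 1) ω)| ≤ A :=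
    fun ω => abs_blockMean_le hA (k + 1) _
  have iNM := integrable_mul_of_bounded (m := P) hN hM bN bM
  have iM := integrable_mul_of_bounded (m := P) hM hM bM bM
  have iN := integrable_mul_of_bounded (m := P) hN hN bN bN
  have e : ∀ ω, (blockMean P ζ φ (k + 1) (block ζ (k + 1) ω)
      - blockMean P ζ φ k (block ζ k ω)) ^ 2
      = blockMean P ζ φ (k + 1) (block ζ (k + 1) ω) * blockMean P ζ φ (k + 1) (block ζ (k + 1) ω)
        - 2 * (blockMean P ζ φ (k + 1) (block ζ (k + 1) ω) * blockMean P ζ φ k (block ζ k ω))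
        + blockMean P ζ φ k (block ζ k ω) * blockMean P ζ φ k (block ζ k ω) := fun ω => by ring
  simp only [e]
  rw [integral_add (by exact iN.sub (iNM.const_mul 2)) iM, integral_sub iN (iNM.const_mul 2),
    integral_const_mul, ← h₂, h₁]
  simp only [pow_two]
  ring

/-- If `ζ 0` and `ζ (k + 1)` are interchangeable given `(ζ 1, …, ζ k)`, the failure of their
conditional independence is controlled by the increment of the martingale `blockMean`. -/
lemma integral_mul_le_blockMean (hζ : ∀ i, Measurable (ζ i)) (hφ : Measurable φ)
    (hA : ∀ z, |φ z| ≤ A) (hψ : Measurable ψ) (hB : ∀ z, |ψ z| ≤ B) {k : ℕ}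
    (hswap : P.map (fun ω => (ζ (k + 1) ω, block ζ k ω)) = P.map fun ω => (ζ 0 ω, block ζ k ω))
    {δ : ℝ} (hδ : 0 < δ) :
    ∫ ω, blockMean P ζ φ k (block ζ k ω) * blockMean P ζ ψ k (block ζ k ω) ∂P
      ≤ ∫ ω, φ (ζ 0 ω) * ψ (ζ (k + 1) ω) ∂P + δ
        + B ^ 2 / δ * (∫ ω, blockMean P ζ φ (k + 1) (block ζ (k + 1) ω) ^ 2 ∂P
          - ∫ ω, blockMean P ζ φ k (block ζ k ω) ^ 2 ∂P) := by
  have hMm := measurable_blockMean (P := P) (ζ := ζ) hφ k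
  have hM := hMm.comp (measurable_block hζ k)
  have hN := (measurable_blockMean (P := P) (ζ := ζ) hφ (k + 1)).comp
    (measurable_block hζ (k + 1))
  simp only [Function.comp_def] at hM hN
  have h₁ : ∫ ω, φ (ζ 0 ω) * ψ (ζ (k + 1) ω) ∂P
      = ∫ ω, blockMean P ζ φ (k + 1) (block ζ (k + 1) ω) * ψ (ζ (k + 1) ω) ∂P := by
    have := integral_mul_block (P := P) hζ hφ hA (k := k + 1)
      (g := fun w => ψ (w (Fin.last k))) (by fun_prop) (fun w => hB _)
    simpa [block] using! this
  have h₂ : ∫ ω, blockMean P ζ φ k (block ζ k ω) * blockMean P ζ ψ k (block ζ k ω) ∂P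
      = ∫ ω, blockMean P ζ φ k (block ζ k ω) * ψ (ζ (k + 1) ω) ∂P := by
    have h := integral_mul_block (P := P) hζ hψ hB hMm (abs_blockMean_le hA k)
    have hF : Measurable fun p : Z × (Fin k → Z) => blockMean P ζ φ k p.2 * ψ p.1 := by fun_prop
    have hs := congrArg (fun m => ∫ p, blockMean P ζ φ k p.2 * ψ p.1 ∂m) hswap
    rw [integral_map ((hζ _).prodMk (measurable_block hζ k)).aemeasurable
        hF.aestronglyMeasurable,
      integral_map ((hζ _).prodMk (measurable_block hζ k)).aemeasurable
        hF.aestronglyMeasurable] at hs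
    rw [hs]
    simpa only [mul_comm] using h.symm
  have hψζ : Measurable fun ω => ψ (ζ (k + 1) ω) := hψ.comp (hζ (k + 1))
  have iM := integrable_mul_of_bounded (m := P) hM hψζ (fun ω => abs_blockMean_le hA k _)
    (fun ω => hB _)
  have iN := integrable_mul_of_bounded (m := P) hN hψζ (fun ω => abs_blockMean_le hA (k + 1) _)
    (fun ω => hB _)
  have iD : Integrable (fun ω => (blockMean P ζ φ (k + 1) (block ζ (k + 1) ω)
      - blockMean P ζ φ k (block ζ k ω)) ^ 2) P := by
    have hd : ∀ ω, |blockMean P ζ φ (k + 1) (block ζ (k + 1) ω)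
        - blockMean P ζ φ k (block ζ k ω)| ≤ A + A := fun ω =>
      (abs_sub _ _).trans (add_le_add (abs_blockMean_le hA _ _) (abs_blockMean_le hA _ _))
    simp only [pow_two]
    exact integrable_mul_of_bounded (hN.sub hM) (hN.sub hM) hd hd
  rw [h₁, h₂, ← integral_sq_sub_blockMean hζ hφ hA k]
  have iδ : Integrable (fun _ : Ω => δ) P := integrable_const δ
  have key : ∫ ω, blockMean P ζ φ k (block ζ k ω) * ψ (ζ (k + 1) ω) ∂P
      ≤ ∫ ω, (blockMean P ζ φ (k + 1) (block ζ (k + 1) ω) * ψ (ζ (k + 1) ω) + δ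
        + B ^ 2 / δ * (blockMean P ζ φ (k + 1) (block ζ (k + 1) ω)
          - blockMean P ζ φ k (block ζ k ω)) ^ 2) ∂P := by
    refine integral_mono iM ((iN.add iδ).add (iD.const_mul _)) fun ω => ?_
    simp only
    generalize blockMean P ζ φ (k + 1) (block ζ (k + 1) ω) = a
    generalize blockMean P ζ φ k (block ζ k ω) = b
    have hb := hB (ζ (k + 1) ω)
    generalize ψ (ζ (k + 1) ω) = p at hb
    have hsq : p ^ 2 ≤ B ^ 2 := sq_le_sq' (abs_le.1 hb).1 (abs_le.1 hb).2
    have h3 : p ^ 2 / δ * (a - b) ^ 2 ≤ B ^ 2 / δ * (a - b) ^ 2 := by gcongr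
    have h4 : 0 ≤ (δ + p * (a - b) / 2) ^ 2 / δ := by positivity
    have h5 : (δ + p * (a - b) / 2) ^ 2 / δ
        = δ + p * (a - b) + p ^ 2 / δ * (a - b) ^ 2 / 4 := by field_simp; ring
    have h6 : 0 ≤ p ^ 2 / δ * (a - b) ^ 2 := by positivity
    nlinarith
  refine key.trans_eq ?_
  rw [integral_add (by exact iN.add iδ) (iD.const_mul _), integral_add iN iδ, integral_const_mul]
  simp

/-- A function of `ζ 0` independent of `(ζ 1, …, ζ k)` keeps its law under conditioning. -/
lemma map_blockKernel_of_indep {X : Type*} [MeasurableSpace X] [StandardBorelSpace X] [Nonempty X]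
    {f : Z → X} (hf : Measurable f) {μ : Measure X} [IsProbabilityMeasure μ]
    (hζ : ∀ i, Measurable (ζ i)) {k : ℕ}
    (h : P.map (fun ω => (f (ζ 0 ω), block ζ k ω)) = μ.prod (P.map (block ζ k))) :
    ∀ᵐ w ∂(P.map (block ζ k)), (blockKernel P ζ k w).map f = μ := by
  have hm := measurable_block hζ k
  have h' : P.map (fun ω => (block ζ k ω, (f ∘ ζ 0) ω))
      = P.map (block ζ k) ⊗ₘ Kernel.const _ μ := by
    rw [Measure.compProd_const]
    have := congrArg (Measure.map Prod.swap) h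
    rwa [Measure.prod_swap, Measure.map_map measurable_swap
      (by exact (hf.comp (hζ 0)).prodMk hm)] at this
  have h₁ := condDistrib_ae_eq_of_measure_eq_compProd (block ζ k)
    (hf.comp (hζ 0)).aemeasurable h'
  have h₂ := condDistrib_comp (mβ := MeasurableSpace.pi) (μ := P) (block ζ k) (hζ 0).aemeasurable hf
  filter_upwards [h₁, h₂] with w hw₁ hw₂
  rw [← Kernel.map_apply _ hf, blockKernel, ← hw₂, hw₁, Kernel.const_apply]

end Conditioning

section ProductMeasure

variable {ι κ κ' Z : Type*} [Fintype ι] [Fintype κ] [Fintype κ'] [MeasurableSpace Z]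
  (π : Measure Z) [IsProbabilityMeasure π]

lemma map_pi_comp_of_injective {e : κ → ι} (he : Function.Injective e) :
    (Measure.pi fun _ : ι => π).map (fun z j => z (e j)) = Measure.pi fun _ : κ => π := by
  have h := (iIndepFun_pi (μ := fun _ : ι => π) (X := fun _ => id)
    fun _ => aemeasurable_id).precomp he
  have h' := h.map_fun_eq_pi_map fun j => (measurable_pi_apply (e j)).aemeasurable
  refine h'.trans ?_
  congr 1
  ext1 j
  exact (measurePreserving_eval (fun _ : ι => π) (e j)).map_eq

lemma indepFun_pi_comp {e : κ → ι} {e' : κ' → ι} (h : ∀ i j, e i ≠ e' j) :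
    IndepFun (fun (z : ι → Z) j => z (e j)) (fun z j => z (e' j)) (Measure.pi fun _ => π) := by
  classical
  have hd : Disjoint (Finset.univ.image e) (Finset.univ.image e') := by
    rw [Finset.disjoint_left]
    simp only [Finset.mem_image, Finset.mem_univ, true_and]
    rintro _ ⟨i, rfl⟩ ⟨j, hj⟩
    exact h i j hj.symm
  have hi := (iIndepFun_pi (μ := fun _ : ι => π) (X := fun _ => id)
    fun _ => aemeasurable_id).indepFun_finset _ _ hd fun i => measurable_pi_apply i
  exact hi.comp
    (φ := fun u j => u ⟨e j, Finset.mem_image_of_mem e (Finset.mem_univ j)⟩)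
    (ψ := fun u j => u ⟨e' j, Finset.mem_image_of_mem e' (Finset.mem_univ j)⟩)
    (by fun_prop) (by fun_prop)

lemma map_pi_prodMk_ne {W : Type*} [MeasurableSpace W] {p : Z → W} (hp : Measurable p) (i : ι) :
    (Measure.pi fun _ : ι => π).map (fun z => (p (z i), fun j : {j // j ≠ i} => z j.1))
      = (π.map p).prod ((Measure.pi fun _ : ι => π).map fun z (j : {j // j ≠ i}) => z j.1) := by
  classical
  have hi := (indepFun_pi_comp π (e := fun _ : Unit => i) (e' := fun j : {j : ι // j ≠ i} => j.1)
    (fun _ j => j.2.symm)).comp (φ := fun u : Unit → Z => p (u ())) (ψ := id)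
    (hp.comp (measurable_pi_apply ())) measurable_id
  have hev := (measurePreserving_eval (fun _ : ι => π) i).map_eq
  have hpe : Measurable fun z : ι → Z => p (z i) := hp.comp (measurable_pi_apply i)
  have hrest : Measurable fun (z : ι → Z) (j : {j : ι // j ≠ i}) => z j.1 :=
    measurable_pi_lambda _ fun j => measurable_pi_apply _
  have hmap : (Measure.pi fun _ : ι => π).map (fun z => p (z i)) = π.map p := by
    conv_rhs => rw [← hev, Measure.map_map hp (measurable_pi_apply i)]
    rfl
  rw [← hmap]
  exact (indepFun_iff_map_prod_eq_prod_map_map hpe.aemeasurable hrest.aemeasurable).1 hi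

end ProductMeasure

section Feasibility

variable {X Y : Type*} [MeasurableSpace X] [MeasurableSpace Y] {μ : Measure X} {ν : Measure Y}
  {π : Measure (X × Y)}

lemma symCond_pi [IsProbabilityMeasure π] (r : ℕ) : SymCond r (Measure.pi fun _ => π) :=
  fun σ => map_pi_comp_of_injective π σ.injective

lemma marCond_pi [IsProbabilityMeasure π] (h₁ : π.map Prod.fst = μ) (h₂ : π.map Prod.snd = ν)
    (r : ℕ) : MarCond r μ ν (Measure.pi fun _ => π) :=
  fun i => ⟨h₁ ▸ map_pi_prodMk_ne π measurable_fst i, h₂ ▸ map_pi_prodMk_ne π measurable_snd i⟩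

lemma psdCond_pi [IsProbabilityMeasure π] (r : ℕ) : PSDCond r (Measure.pi fun _ => π) := by
  intro t ht f g hf _ hg _ hg0
  set Q : Measure (Fin (2 * r) → X × Y) := Measure.pi fun _ => π
  let e₁ : Fin t → Fin (2 * r) := fun s => ⟨s.1, by omega⟩
  let e₂ : Fin t → Fin (2 * r) := fun s => ⟨t + s.1, by omega⟩
  let e₃ : Fin (2 * r - 2 * t) → Fin (2 * r) := fun s => ⟨2 * t + s.1, by omega⟩
  have i₁₂ : IndepFun (fun z : Fin (2 * r) → X × Y => f fun s => z (e₁ s))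
      (fun z => f fun s => z (e₂ s)) Q :=
    (indepFun_pi_comp π (e := e₁) (e' := e₂)
      fun i j h => by simp only [e₁, e₂, Fin.mk.injEq] at h; omega).comp hf hf
  have i₁₂₃ : IndepFun (fun z : Fin (2 * r) → X × Y =>
      (f fun s => z (e₁ s)) * f fun s => z (e₂ s)) (fun z => g fun s => z (e₃ s)) Q :=
    (indepFun_pi_comp π (e := Sum.elim e₁ e₂) (e' := e₃) (by
      rintro (i | i) j h <;> simp only [e₁, e₂, e₃, Sum.elim_inl, Sum.elim_inr,
        Fin.mk.injEq] at h <;> omega)).comp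
      (φ := fun u : Fin t ⊕ Fin t → X × Y => (f fun s => u (Sum.inl s)) * f fun s => u (Sum.inr s))
      (by fun_prop) hg
  have hmean : ∀ e : Fin t → Fin (2 * r), Function.Injective e →
      ∫ z, f (fun s => z (e s)) ∂Q = ∫ w, f w ∂(Measure.pi fun _ => π) := by
    intro e he
    have hm : Measurable fun (z : Fin (2 * r) → X × Y) s => z (e s) := by fun_prop
    rw [← map_pi_comp_of_injective π he, integral_map hm.aemeasurable hf.aestronglyMeasurable]
  have m₁ : Measurable fun z : Fin (2 * r) → X × Y => f fun s => z (e₁ s) := by fun_prop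
  have m₂ : Measurable fun z : Fin (2 * r) → X × Y => f fun s => z (e₂ s) := by fun_prop
  have m₃ : Measurable fun z : Fin (2 * r) → X × Y => g fun s => z (e₃ s) := by fun_prop
  have h := i₁₂₃.integral_fun_mul_eq_mul_integral (m₁.mul m₂).aestronglyMeasurable
    m₃.aestronglyMeasurable
  rw [i₁₂.integral_fun_mul_eq_mul_integral m₁.aestronglyMeasurable m₂.aestronglyMeasurable,
    hmean e₁ fun i j h => by simpa [e₁, Fin.ext_iff] using h,
    hmean e₂ fun i j h => by simpa [e₂, Fin.ext_iff] using h] at h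
  refine le_of_le_of_eq ?_ h.symm
  exact mul_nonneg (mul_self_nonneg _) (integral_nonneg fun z => hg0 _)

lemma pi_mem_PiRSet (hπ : π ∈ Couplings μ ν) (r : ℕ) :
    (Measure.pi fun _ => π) ∈ PiRSet r μ ν := by
  obtain ⟨_, h₁, h₂⟩ := hπ
  exact ⟨inferInstance, symCond_pi r, marCond_pi h₁ h₂ r, psdCond_pi r⟩

lemma prod_mem_Couplings [IsProbabilityMeasure μ] [IsProbabilityMeasure ν] :
    μ.prod ν ∈ Couplings μ ν :=
  ⟨inferInstance, by simp [Measure.map_fst_prod], by simp [Measure.map_snd_prod]⟩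

lemma integral_pi_pair [IsProbabilityMeasure π] {ι : Type*} [Fintype ι] {i j : ι} (hij : i ≠ j)
    {c : X × Y → X × Y → ℝ} (hc : Measurable fun p : (X × Y) × (X × Y) => c p.1 p.2) :
    ∫ z, c (z i) (z j) ∂(Measure.pi fun _ : ι => π) = ∫ p, c p.1 p.2 ∂(π.prod π) := by
  have h := (indepFun_pi_comp π (e := fun _ : Unit => i) (e' := fun _ : Unit => j)
    (fun _ _ => hij)).comp (measurable_pi_apply ()) (measurable_pi_apply ())
  have hm : Measurable fun z : ι → X × Y => (z i, z j) := by fun_prop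
  have h' : (Measure.pi fun _ : ι => π).map (fun z => (z i, z j)) = π.prod π := by
    refine ((indepFun_iff_map_prod_eq_prod_map_map (measurable_pi_apply i).aemeasurable
      (measurable_pi_apply j).aemeasurable).1 h).trans ?_
    congr 1
    exacts [(measurePreserving_eval (fun _ : ι => π) i).map_eq,
      (measurePreserving_eval (fun _ : ι => π) j).map_eq]
  rw [← h', integral_map hm.aemeasurable hc.aestronglyMeasurable]

end Feasibility

section Approximation

variable {Z : Type*} [MetricSpace Z] [CompactSpace Z] [MeasurableSpace Z] [BorelSpace Z]

/-- A continuous function of two variables on a compact metric space is a uniform limit of finite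
sums of products of bounded measurable functions. -/
lemma exists_sum_mul_approx {c : Z → Z → ℝ} (hc : Continuous fun p : Z × Z => c p.1 p.2)
    {K : ℝ} (hK : ∀ z w, |c z w| ≤ K) {ε : ℝ} (hε : 0 < ε) :
    ∃ (m : ℕ) (φ ψ : Fin m → Z → ℝ), (∀ i, Measurable (φ i)) ∧ (∀ i, Measurable (ψ i)) ∧
      (∀ i z, |φ i z| ≤ 1) ∧ (∀ i z, |ψ i z| ≤ K) ∧
      ∀ z w, |c z w - ∑ i, φ i z * ψ i w| ≤ ε := by
  rcases isEmpty_or_nonempty Z with hZ | hZ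
  · exact ⟨0, fun _ _ => 0, fun _ _ => 0, by simp, by simp, by simp, by simp, fun z => hZ.elim z⟩
  obtain ⟨δ, hδ, hcδ⟩ := Metric.uniformContinuous_iff.1
    (CompactSpace.uniformContinuous_of_continuous hc) ε hε
  let e := TopologicalSpace.denseSeq Z
  obtain ⟨T, hT⟩ := isCompact_univ.elim_finite_subcover (fun k => Metric.ball (e k) δ)
    (fun _ => Metric.isOpen_ball) (fun x _ => by
      obtain ⟨k, hk⟩ := (TopologicalSpace.denseRange_denseSeq Z).exists_dist_lt x hδ
      exact mem_iUnion.2 ⟨k, hk⟩)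
  obtain ⟨N, hN⟩ := T.exists_le
  let q := SimpleFunc.nearestPtInd e N
  have hq : ∀ z, dist (e (q z)) z < δ := by
    intro z
    obtain ⟨k, hk, hz⟩ := mem_iUnion₂.1 (hT (mem_univ z))
    have h := SimpleFunc.edist_nearestPt_le e z (hN k hk)
    rw [edist_dist, edist_dist, ENNReal.ofReal_le_ofReal_iff dist_nonneg] at h
    rw [mem_ball'] at hz
    exact h.trans_lt hz
  refine ⟨N + 1, fun i => (q ⁻¹' {i.1}).indicator 1, fun i => c (e i), fun i => ?_, fun i => ?_,
    fun i z => ?_, fun i z => hK _ _, fun z w => ?_⟩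
  · exact measurable_one.indicator (q.measurableSet_preimage _)
  · exact (hc.comp (Continuous.prodMk_right (e i))).measurable
  · by_cases h : z ∈ q ⁻¹' {i.1} <;> simp [h]
  · have hs : ∑ i : Fin (N + 1), (q ⁻¹' {i.1}).indicator (1 : Z → ℝ) z * c (e i) w
        = c (e (q z)) w := by
      rw [Finset.sum_eq_single ⟨q z, Nat.lt_succ_of_le (SimpleFunc.nearestPtInd_le e N z)⟩]
      · simp
      · intro i _ hi
        have : q z ≠ i.1 := fun h => hi (Fin.ext h.symm)
        simp [this]
      · simp
    rw [hs, ← Real.dist_eq]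
    refine (hcδ (a := (z, w)) (b := (e (q z), w)) ?_).le
    rw [Prod.dist_eq, dist_self, max_eq_left dist_nonneg, dist_comm]
    exact hq z

end Approximation

section Rounding

variable {X Y : Type*}

/-- The coordinates of a `2r`-tuple, extended to a sequence by repeating the first one. -/
def coordSeq {r : ℕ} (hr : 0 < r) (i : ℕ) (z : Fin (2 * r) → X × Y) : X × Y :=
  if h : i < 2 * r then z ⟨i, h⟩ else z ⟨0, by omega⟩

lemma coordSeq_of_lt {r : ℕ} (hr : 0 < r) {i : ℕ} (h : i < 2 * r) (z : Fin (2 * r) → X × Y) :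
    coordSeq hr i z = z ⟨i, h⟩ :=
  dif_pos h

variable [MeasurableSpace X] [MeasurableSpace Y]

lemma measurable_coordSeq {r : ℕ} (hr : 0 < r) (i : ℕ) :
    Measurable (coordSeq (X := X) (Y := Y) hr i) := by
  unfold coordSeq
  split <;> exact measurable_pi_apply _

variable {μ : Measure X} {ν : Measure Y}

lemma map_coordSeq_swap {r : ℕ} (hr : 0 < r) {P : Measure (Fin (2 * r) → X × Y)}
    (hP : SymCond r P) {k : ℕ} (hk : k + 1 < 2 * r) :
    P.map (fun z => (coordSeq hr (k + 1) z, block (coordSeq hr) k z))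
      = P.map fun z => (coordSeq hr 0 z, block (coordSeq hr) k z) := by
  have hm : Measurable fun z : Fin (2 * r) → X × Y =>
      (coordSeq hr 0 z, block (coordSeq hr) k z) :=
    (measurable_coordSeq hr 0).prodMk (measurable_block (measurable_coordSeq hr) k)
  let σ : Equiv.Perm (Fin (2 * r)) := Equiv.swap ⟨0, by omega⟩ ⟨k + 1, hk⟩
  conv_rhs => rw [← hP σ]
  rw [Measure.map_map hm (by fun_prop)]
  congr 1
  ext1 z
  refine Prod.ext ?_ (funext fun s => ?_)
  · simp [coordSeq_of_lt hr hk, coordSeq_of_lt hr (show 0 < 2 * r by omega), σ]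
  · have hs : s.1 + 1 < 2 * r := by omega
    have h : σ ⟨s.1 + 1, hs⟩ = ⟨s.1 + 1, hs⟩ :=
      Equiv.swap_apply_of_ne_of_ne (by simp) (by simp [Fin.ext_iff]; omega)
    simp [block, coordSeq_of_lt hr hs, h]

lemma integral_coordSeq_pair {r : ℕ} (hr : 0 < r) {P : Measure (Fin (2 * r) → X × Y)}
    (hP : SymCond r P) {c : X × Y → X × Y → ℝ}
    (hc : Measurable fun p : (X × Y) × (X × Y) => c p.1 p.2) {k : ℕ} (hk : k + 1 < 2 * r) :
    ∫ z, c (coordSeq hr 0 z) (coordSeq hr (k + 1) z) ∂P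
      = ∫ z, c (z ⟨0, by omega⟩) (z ⟨1, by omega⟩) ∂P := by
  let σ : Equiv.Perm (Fin (2 * r)) := Equiv.swap ⟨1, by omega⟩ ⟨k + 1, hk⟩
  have hm : Measurable fun z : Fin (2 * r) → X × Y => c (z ⟨0, by omega⟩) (z ⟨1, by omega⟩) :=
    hc.comp (f := fun z : Fin (2 * r) → X × Y => (z ⟨0, by omega⟩, z ⟨1, by omega⟩))
      (by fun_prop)
  have h₀ : σ ⟨0, by omega⟩ = ⟨0, by omega⟩ :=
    Equiv.swap_apply_of_ne_of_ne (by simp) (by simp)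
  have hσ : Measurable fun z : Fin (2 * r) → X × Y => z ∘ σ := by fun_prop
  conv_rhs => rw [← hP σ, integral_map hσ.aemeasurable hm.aestronglyMeasurable]
  simp [coordSeq_of_lt hr hk, coordSeq_of_lt hr (show 0 < 2 * r by omega), h₀, σ]

lemma map_coordSeq_indep {r : ℕ} (hr : 0 < r) {P : Measure (Fin (2 * r) → X × Y)}
    [IsProbabilityMeasure P] {W : Type*} [MeasurableSpace W] {ρ : Measure W}
    [IsProbabilityMeasure ρ] {p : X × Y → W} (hp : Measurable p)
    (h : P.map (fun z => (p (z ⟨0, by omega⟩),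
        fun j : {j : Fin (2 * r) // j ≠ ⟨0, by omega⟩} => z j.1))
      = ρ.prod (P.map (fun z (j : {j : Fin (2 * r) // j ≠ ⟨0, by omega⟩}) => z j.1)))
    {k : ℕ} (hk : k + 1 < 2 * r) :
    P.map (fun z => (p (coordSeq hr 0 z), block (coordSeq hr) k z))
      = ρ.prod (P.map (block (coordSeq hr) k)) := by
  let R : ({j : Fin (2 * r) // j ≠ ⟨0, by omega⟩} → X × Y) → Fin k → X × Y :=
    fun u s => u ⟨⟨s.1 + 1, by omega⟩, by simp⟩
  have hR : Measurable R := by fun_prop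
  have hrest : Measurable fun (z : Fin (2 * r) → X × Y)
      (j : {j : Fin (2 * r) // j ≠ ⟨0, by omega⟩}) => z j.1 := by fun_prop
  have hpe : Measurable fun z : Fin (2 * r) → X × Y => p (z ⟨0, by omega⟩) := by fun_prop
  have hblock : ∀ z : Fin (2 * r) → X × Y, block (coordSeq hr) k z = R fun j => z j.1 :=
    fun z => funext fun s => coordSeq_of_lt hr (by omega) z
  have hmap : P.map (block (coordSeq hr) k)
      = (P.map fun z (j : {j : Fin (2 * r) // j ≠ ⟨0, by omega⟩}) => z j.1).map R := by
    rw [Measure.map_map hR hrest]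
    congr 1
    exact funext hblock
  have h' := congrArg (Measure.map (Prod.map id R)) h
  have := Measure.isProbabilityMeasure_map (μ := P) hrest.aemeasurable
  rw [Measure.map_map (measurable_id.prodMap hR) (hpe.prodMk hrest),
    ← Measure.map_prod_map ρ _ measurable_id hR, Measure.map_id, ← hmap] at h'
  rw [← h']
  congr 1
  funext z
  simp [hblock, coordSeq_of_lt hr (show 0 < 2 * r by omega)]

lemma bddBelow_gw {c : X × Y → X × Y → ℝ} {K : ℝ} (hK : ∀ z w, |c z w| ≤ K) :
    BddBelow (range fun π : Couplings μ ν =>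
      ∫ z, c z.1 z.2 ∂((π : Measure (X × Y)).prod (π : Measure (X × Y)))) := by
  refine ⟨-K, ?_⟩
  rintro _ ⟨⟨π, hπ, -, -⟩, rfl⟩
  exact (abs_le.1 (abs_integral_le_of_bounded fun _ => hK _ _)).1

lemma bddBelow_gwR {c : X × Y → X × Y → ℝ} {K : ℝ} (hK : ∀ z w, |c z w| ≤ K) {r : ℕ}
    (hr : 0 < r) :
    BddBelow (range fun P : PiRSet r μ ν =>
      ∫ z, c (z ⟨0, by omega⟩) (z ⟨1, by omega⟩) ∂(P : Measure (Fin (2 * r) → X × Y))) := by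
  refine ⟨-K, ?_⟩
  rintro _ ⟨⟨P, hP, -⟩, rfl⟩
  exact (abs_le.1 (abs_integral_le_of_bounded fun z => hK _ _)).1

variable {c : X × Y → X × Y → ℝ} {K ε δ : ℝ} {m : ℕ} {φ ψ : Fin m → X × Y → ℝ}

lemma integral_prod_self_le_sum (hφ : ∀ i, Measurable (φ i)) (hψ : ∀ i, Measurable (ψ i))
    (hφ1 : ∀ i z, |φ i z| ≤ 1) (hψK : ∀ i z, |ψ i z| ≤ K)
    (hc : Measurable fun p : (X × Y) × (X × Y) => c p.1 p.2) (hK : ∀ z w, |c z w| ≤ K)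
    (happ : ∀ z w, |c z w - ∑ i, φ i z * ψ i w| ≤ ε) (π : Measure (X × Y))
    [IsProbabilityMeasure π] :
    ∫ p, c p.1 p.2 ∂(π.prod π) ≤ ε + ∑ i, (∫ z, φ i z ∂π) * ∫ z, ψ i z ∂π := by
  have ii : ∀ i, Integrable (fun p : (X × Y) × (X × Y) => φ i p.1 * ψ i p.2) (π.prod π) :=
    fun i => integrable_mul_of_bounded ((hφ i).comp measurable_fst) ((hψ i).comp measurable_snd)
      (fun _ => hφ1 i _) (fun _ => hψK i _)
  have is := integrable_finsetSum Finset.univ fun i _ => ii i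
  calc ∫ p, c p.1 p.2 ∂(π.prod π)
      ≤ ∫ p, (ε + ∑ i, φ i p.1 * ψ i p.2) ∂(π.prod π) := by
        refine integral_mono (integrable_of_measurable_of_bounded hc fun p => hK _ _)
          ((integrable_const ε).add is) fun p => ?_
        have := (abs_le.1 (happ p.1 p.2)).2
        simp only
        linarith
    _ = _ := by
        rw [integral_add (integrable_const ε) is, integral_finsetSum _ fun i _ => ii i]
        simp [integral_prod_mul]

variable [StandardBorelSpace X] [StandardBorelSpace Y] [Nonempty X] [Nonempty Y]
  [IsProbabilityMeasure μ] [IsProbabilityMeasure ν]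

lemma blockKernel_mem_Couplings {r : ℕ} (hr : 0 < r) {P : Measure (Fin (2 * r) → X × Y)}
    [IsProbabilityMeasure P] (hP : MarCond r μ ν P) {k : ℕ} (hk : k + 1 < 2 * r) :
    ∀ᵐ z ∂P, blockKernel P (coordSeq hr) k (block (coordSeq hr) k z) ∈ Couplings μ ν := by
  have hζ := measurable_coordSeq (X := X) (Y := Y) hr
  obtain ⟨h₁, h₂⟩ := hP ⟨0, by omega⟩
  have a₁ := map_blockKernel_of_indep measurable_fst hζ
    (map_coordSeq_indep hr measurable_fst h₁ hk)
  have a₂ := map_blockKernel_of_indep measurable_snd hζ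
    (map_coordSeq_indep hr measurable_snd h₂ hk)
  have hm := (measurable_block hζ k).aemeasurable (μ := P)
  filter_upwards [ae_of_ae_map hm a₁, ae_of_ae_map hm a₂] with z hz₁ hz₂
  exact ⟨inferInstance, hz₁, hz₂⟩

lemma gwVal_le_of_index {r : ℕ} (hr : 0 < r) {P : Measure (Fin (2 * r) → X × Y)}
    [IsProbabilityMeasure P] (hS : SymCond r P) (hM : MarCond r μ ν P)
    (hφ : ∀ i, Measurable (φ i)) (hψ : ∀ i, Measurable (ψ i))
    (hφ1 : ∀ i z, |φ i z| ≤ 1) (hψK : ∀ i z, |ψ i z| ≤ K)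
    (hc : Measurable fun p : (X × Y) × (X × Y) => c p.1 p.2) (hK : ∀ z w, |c z w| ≤ K)
    (happ : ∀ z w, |c z w - ∑ i, φ i z * ψ i w| ≤ ε) (hδ : 0 < δ) {k : ℕ} (hk : k + 1 < 2 * r) :
    gwVal c μ ν ≤ ∫ z, c (z ⟨0, by omega⟩) (z ⟨1, by omega⟩) ∂P + 2 * ε + m * δ
      + K ^ 2 / δ * ∑ i,
        (∫ z, blockMean P (coordSeq hr) (φ i) (k + 1) (block (coordSeq hr) (k + 1) z) ^ 2 ∂P
          - ∫ z, blockMean P (coordSeq hr) (φ i) k (block (coordSeq hr) k z) ^ 2 ∂P) := by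
  have hζ := measurable_coordSeq (X := X) (Y := Y) hr
  have hmean : ∀ {f : X × Y → ℝ}, Measurable f →
      Measurable fun z => blockMean P (coordSeq hr) f k (block (coordSeq hr) k z) :=
    fun hf => (measurable_blockMean hf k).comp (measurable_block hζ k)
  have iMN : ∀ i, Integrable (fun z =>
      blockMean P (coordSeq hr) (φ i) k (block (coordSeq hr) k z)
        * blockMean P (coordSeq hr) (ψ i) k (block (coordSeq hr) k z)) P := fun i =>
    integrable_mul_of_bounded (hmean (hφ i)) (hmean (hψ i))
      (fun _ => abs_blockMean_le (hφ1 i) k _) (fun _ => abs_blockMean_le (hψK i) k _)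
  have isMN := integrable_finsetSum Finset.univ fun i _ => iMN i
  have h₁ : gwVal c μ ν ≤ ε + ∑ i, ∫ z,
      blockMean P (coordSeq hr) (φ i) k (block (coordSeq hr) k z)
        * blockMean P (coordSeq hr) (ψ i) k (block (coordSeq hr) k z) ∂P := by
    calc gwVal c μ ν = ∫ _, gwVal c μ ν ∂P := by simp
      _ ≤ ∫ z, (ε + ∑ i, blockMean P (coordSeq hr) (φ i) k (block (coordSeq hr) k z)
          * blockMean P (coordSeq hr) (ψ i) k (block (coordSeq hr) k z)) ∂P := by
        refine integral_mono_ae (integrable_const _) ((integrable_const ε).add isMN) ?_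
        filter_upwards [blockKernel_mem_Couplings hr hM hk] with z hz
        exact (ciInf_le (bddBelow_gw hK) ⟨_, hz⟩).trans
          (integral_prod_self_le_sum hφ hψ hφ1 hψK hc hK happ _)
      _ = _ := by
        rw [integral_add (integrable_const ε) isMN, integral_finsetSum _ fun i _ => iMN i]
        simp
  have iφψ : ∀ i, Integrable (fun z =>
      φ i (coordSeq hr 0 z) * ψ i (coordSeq hr (k + 1) z)) P := fun i =>
    integrable_mul_of_bounded ((hφ i).comp (hζ _)) ((hψ i).comp (hζ _))
      (fun _ => hφ1 i _) (fun _ => hψK i _)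
  have h₂ : ∑ i, ∫ z, φ i (coordSeq hr 0 z) * ψ i (coordSeq hr (k + 1) z) ∂P
      ≤ ε + ∫ z, c (z ⟨0, by omega⟩) (z ⟨1, by omega⟩) ∂P := by
    have ic : Integrable (fun z => c (coordSeq hr 0 z) (coordSeq hr (k + 1) z)) P :=
      integrable_of_measurable_of_bounded (hc.comp ((hζ 0).prodMk (hζ (k + 1)))) fun _ => hK _ _
    rw [← integral_coordSeq_pair hr hS hc hk, ← integral_finsetSum _ fun i _ => iφψ i]
    calc _ ≤ ∫ z, (ε + c (coordSeq hr 0 z) (coordSeq hr (k + 1) z)) ∂P := by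
          refine integral_mono (integrable_finsetSum Finset.univ fun i _ => iφψ i)
            ((integrable_const ε).add ic) fun z => ?_
          have := (abs_le.1 (happ (coordSeq hr 0 z) (coordSeq hr (k + 1) z))).1
          simp only
          linarith
      _ = _ := by rw [integral_add (integrable_const ε) ic]; simp
  have h₃ := Finset.sum_le_sum fun i (_ : i ∈ Finset.univ) =>
    integral_mul_le_blockMean hζ (hφ i) (hφ1 i) (hψ i) (hψK i) (map_coordSeq_swap hr hS hk) hδ
  rw [Finset.sum_add_distrib, Finset.sum_add_distrib, ← Finset.mul_sum] at h₃
  simp only [Finset.sum_const, Finset.card_univ, Fintype.card_fin, nsmul_eq_mul] at h₃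
  linarith

lemma gwVal_le_of_mem_PiRSet {r : ℕ} (hr : 0 < r) {P : Measure (Fin (2 * r) → X × Y)}
    (hP : P ∈ PiRSet r μ ν) (hφ : ∀ i, Measurable (φ i)) (hψ : ∀ i, Measurable (ψ i))
    (hφ1 : ∀ i z, |φ i z| ≤ 1) (hψK : ∀ i z, |ψ i z| ≤ K)
    (hc : Measurable fun p : (X × Y) × (X × Y) => c p.1 p.2) (hK : ∀ z w, |c z w| ≤ K)
    (happ : ∀ z w, |c z w - ∑ i, φ i z * ψ i w| ≤ ε) (hδ : 0 < δ) :
    gwVal c μ ν ≤ ∫ z, c (z ⟨0, by omega⟩) (z ⟨1, by omega⟩) ∂P + 2 * ε + m * δ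
      + K ^ 2 / δ * m / r := by
  obtain ⟨_, hS, hM, -⟩ := hP
  set E := ∫ z, c (z ⟨0, by omega⟩) (z ⟨1, by omega⟩) ∂P
  let a : ℕ → ℝ := fun k => ∑ i,
    ∫ z, blockMean P (coordSeq hr) (φ i) k (block (coordSeq hr) k z) ^ 2 ∂P
  have hstep : ∀ k ∈ Finset.range r,
      gwVal c μ ν - (E + 2 * ε + m * δ) ≤ K ^ 2 / δ * (a (k + 1) - a k) := by
    intro k hk
    have h := gwVal_le_of_index hr hS hM hφ hψ hφ1 hψK hc hK happ hδ (k := k)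
      (by have := Finset.mem_range.1 hk; omega)
    rw [Finset.sum_sub_distrib] at h
    simp only [a]
    linarith
  have hsum := Finset.sum_le_sum hstep
  rw [← Finset.mul_sum, Finset.sum_range_sub, Finset.sum_const, Finset.card_range,
    nsmul_eq_mul] at hsum
  have ha0 : 0 ≤ a 0 := Finset.sum_nonneg fun i _ => integral_nonneg fun z => sq_nonneg _
  have har : a r ≤ m := by
    have : ∀ i ∈ (Finset.univ : Finset (Fin m)),
        ∫ z, blockMean P (coordSeq hr) (φ i) r (block (coordSeq hr) r z) ^ 2 ∂P ≤ 1 :=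
      fun i _ => (le_abs_self _).trans <| abs_integral_le_of_bounded fun z => by
        rw [abs_pow]
        exact pow_le_one₀ (abs_nonneg _) (abs_blockMean_le (hφ1 i) r _)
    simpa using Finset.sum_le_sum this
  have hr' : (0 : ℝ) < r := by exact_mod_cast hr
  have hfin : (r : ℝ) * (gwVal c μ ν - (E + 2 * ε + m * δ)) ≤ K ^ 2 / δ * m :=
    hsum.trans (by gcongr; linarith)
  have := (le_div_iff₀' hr').2 hfin
  linarith

end Rounding

lemma LipCost.continuous {X Y : Type*} [PseudoMetricSpace X] [PseudoMetricSpace Y] {C : ℝ}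
    {c : X × Y → X × Y → ℝ} (hc : LipCost C c) :
    Continuous fun p : (X × Y) × (X × Y) => c p.1 p.2 := by
  rw [continuous_iff_continuousAt]
  intro q
  rw [ContinuousAt, tendsto_iff_dist_tendsto_zero]
  refine squeeze_zero (g := fun p : (X × Y) × (X × Y) =>
    C * (dist p.1.1 q.1.1 + dist p.1.2 q.1.2 + dist p.2.1 q.2.1 + dist p.2.2 q.2.2))
    (fun _ => dist_nonneg) (fun p => hc p.1 p.2 q.1 q.2) ?_
  have h : Continuous fun p : (X × Y) × (X × Y) =>
    C * (dist p.1.1 q.1.1 + dist p.1.2 q.1.2 + dist p.2.1 q.2.1 + dist p.2.2 q.2.2) := by fun_prop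
  simpa using h.tendsto q

theorem stmt2 {X Y : Type*}
    [MetricSpace X] [CompactSpace X] [PolishSpace X] [MeasurableSpace X] [BorelSpace X]
    [MetricSpace Y] [CompactSpace Y] [PolishSpace Y] [MeasurableSpace Y] [BorelSpace Y]
    (hdX : Metric.diam (Set.univ : Set X) ≤ 1) (hdY : Metric.diam (Set.univ : Set Y) ≤ 1)
    (μ : Measure X) (ν : Measure Y) [IsProbabilityMeasure μ] [IsProbabilityMeasure ν]
    (C : ℝ) (c : X × Y → X × Y → ℝ) (hc : LipCost C c) :
    Filter.Tendsto (fun r : ℕ => gwRVal (r + 1) (Nat.succ_pos r) c μ ν)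
      Filter.atTop (nhds (gwVal c μ ν)) := by
  have : Nonempty X := nonempty_of_isProbabilityMeasure μ
  have : Nonempty Y := nonempty_of_isProbabilityMeasure ν
  have hcont := hc.continuous
  obtain ⟨K, hK'⟩ := isCompact_univ.exists_bound_of_continuousOn hcont.continuousOn
  have hK : ∀ z w, |c z w| ≤ K := fun z w => hK' (z, w) (mem_univ _)
  have hupper : ∀ r : ℕ, gwRVal (r + 1) (Nat.succ_pos r) c μ ν ≤ gwVal c μ ν := by
    intro r
    have : Nonempty (Couplings μ ν) := ⟨⟨_, prod_mem_Couplings⟩⟩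
    refine le_ciInf fun π => ?_
    have : IsProbabilityMeasure (π : Measure (X × Y)) := π.2.1
    refine (ciInf_le (bddBelow_gwR hK (Nat.succ_pos r)) ⟨_, pi_mem_PiRSet π.2 (r + 1)⟩).trans_eq ?_
    exact integral_pi_pair (by simp) hcont.measurable
  rw [Metric.tendsto_atTop]
  intro η hη
  obtain ⟨m, φ, ψ, hφ, hψ, hφ1, hψK, happ⟩ :=
    exists_sum_mul_approx hcont hK (show 0 < η / 8 by positivity)
  set δ : ℝ := η / (8 * (m + 1))
  have hδ : 0 < δ := by positivity
  have hmδ : m * δ ≤ η / 8 := by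
    have : (m + 1) * δ = η / 8 := by simp only [δ]; field_simp
    linarith
  obtain ⟨N, hN⟩ := exists_nat_gt (K ^ 2 / δ * m / (η / 8))
  refine ⟨N, fun r hr => ?_⟩
  have hlower : gwVal c μ ν - η / 2 ≤ gwRVal (r + 1) (Nat.succ_pos r) c μ ν := by
    have : Nonempty (PiRSet (r + 1) μ ν) := ⟨⟨_, pi_mem_PiRSet prod_mem_Couplings (r + 1)⟩⟩
    refine le_ciInf fun P => ?_
    have h := gwVal_le_of_mem_PiRSet (Nat.succ_pos r) P.2 hφ hψ hφ1 hψK hcont.measurable hK happ hδ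
    have hr' : K ^ 2 / δ * m / ((r + 1 : ℕ) : ℝ) ≤ η / 8 := by
      rw [div_lt_iff₀ (by positivity)] at hN
      rw [div_le_iff₀ (by positivity)]
      have : (N : ℝ) ≤ ((r + 1 : ℕ) : ℝ) := by exact_mod_cast hr.trans (Nat.le_succ r)
      nlinarith
    linarith
  rw [Real.dist_eq, abs_lt]
  constructor <;> linarith [hupper r]

end GWSOS
end

section
/- Let π̄ ∈ Π(μ_{c,ε}, ν_{c,ε}) be an atomic coupling of the ε-concentrated measures. Define its ε-extension π̄_{e,ε} := Σ_{i∈[k], j∈[l]} δ_{𝒳_i×𝒴_j} · λ_{ij} · (μ ⊗ ν), where λ_{ij} = 0 if μ(𝒳_i)ν(𝒴_j) = 0 and λ_{ij} = π̄((x_i,y_j))/(μ(𝒳_i)ν(𝒴_j)) otherwise (here δ_{𝒳_i×𝒴_j} denotes the indicator of the set 𝒳_i×𝒴_j). Then π̄_{e,ε} ∈ Π(μ,ν), i.e., its marginals are μ and ν. -/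
open MeasureTheory Metric Filter Set

namespace GWSOS

/-- A measure is the sum of its restrictions to the cells of a finite partition, and the weights of
null cells are irrelevant. -/
theorem sum_smul_restrict_eq [MeasurableSpace X] {ι : Type*} [Fintype ι] (μ : Measure X)
    {A : ι → Set X} (hm : ∀ i, MeasurableSet (A i)) (hd : ∀ i i', i ≠ i' → Disjoint (A i) (A i'))
    (hu : (⋃ i, A i) = univ) {c : ι → ENNReal} (hc : ∀ i, μ (A i) ≠ 0 → c i = 1) :
    ∑ i, c i • μ.restrict (A i) = μ := by
  have h : ∀ i, c i • μ.restrict (A i) = μ.restrict (A i) := fun i => by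
    by_cases hi : μ (A i) = 0
    · simp [Measure.restrict_eq_zero.2 hi]
    · rw [hc i hi, one_smul]
  have hsum := Measure.restrict_iUnion (μ := μ) (fun i i' => hd i i') hm
  rw [hu, Measure.restrict_univ, Measure.sum_fintype] at hsum
  simp only [h]
  exact hsum.symm

theorem injective_of_mem_of_disjoint {ι : Type*} {A : ι → Set X} {x : ι → X}
    (hd : ∀ i i', i ≠ i' → Disjoint (A i) (A i')) (hx : ∀ i, x i ∈ A i) :
    Function.Injective x := fun i i' h => by
  by_contra hne
  exact Set.disjoint_left.1 (hd i i' hne) (hx i) (h ▸ hx i')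

theorem sum_smul_dirac_singleton [MeasurableSpace X] [MeasurableSingletonClass X] {ι : Type*}
    [Fintype ι] {x : ι → X} (hx : Function.Injective x) (a : ι → ENNReal) (i : ι) :
    (∑ i, a i • Measure.dirac (x i)) {x i} = a i := by
  classical
  simp only [Measure.finsetSum_apply, Measure.smul_apply, smul_eq_mul,
    Measure.dirac_apply' _ (measurableSet_singleton _), Set.indicator_apply, mem_singleton_iff,
    hx.eq_iff]
  simp

/-- If the image of `π` under `q` is carried by finitely many distinct atoms, then `π` is carried
by the fibres of `q` over these atoms. -/
theorem sum_measure_inter_fiber {Z : Type*} [MeasurableSpace Z] [MeasurableSpace Y]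
    [MeasurableSingletonClass Y] {ι : Type*} [Fintype ι] (π : Measure Z) {q : Z → Y}
    (hq : Measurable q) {y : ι → Y} (hy : Function.Injective y) (b : ι → ENNReal)
    (hπ : π.map q = ∑ j, b j • Measure.dirac (y j)) {S : Set Z} (hS : MeasurableSet S) :
    ∑ j, π (S ∩ q ⁻¹' {y j}) = π S := by
  have hr : MeasurableSet (range y) := (finite_range y).measurableSet
  have hnull : π (q ⁻¹' (range y)ᶜ) = 0 := by
    rw [← Measure.map_apply hq hr.compl, hπ]
    simp [Measure.finsetSum_apply, Measure.dirac_apply' _ hr.compl]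
  have hunion : (⋃ j, S ∩ q ⁻¹' {y j}) = S ∩ q ⁻¹' range y := by
    ext z
    simp [eq_comm]
  have hdisj : Pairwise (Function.onFun Disjoint fun j => S ∩ q ⁻¹' {y j}) := fun j j' hne => by
    refine Set.disjoint_left.2 fun z hz hz' => hne (hy ?_)
    exact hz.2.symm.trans hz'.2
  rw [← tsum_fintype (L := SummationFilter.unconditional ι),
    ← measure_iUnion hdisj fun j => hS.inter (hq (measurableSet_singleton _)),
    hunion]
  refine measure_inter_conull ?_
  exact hnull

/-- Normalising the atoms `p j` of total mass `a` by `a * b j` gives a density of integral one. -/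
theorem sum_ite_div_mul_eq_one {ι : Type*} [Fintype ι] {a : ENNReal} (ha : a ≠ 0) (ha' : a ≠ ⊤)
    {b p : ι → ENNReal} (hb : ∀ j, b j ≠ ⊤) (hp : ∀ j, p j ≤ b j) (hsum : ∑ j, p j = a) :
    ∑ j, (if a * b j = 0 then 0 else p j / (a * b j)) * b j = 1 := by
  have h : ∀ j, (if a * b j = 0 then 0 else p j / (a * b j)) * b j = p j * a⁻¹ := fun j => by
    by_cases hj : b j = 0
    · have : p j = 0 := le_antisymm (hj ▸ hp j) zero_le
      simp [hj, this]
    · rw [if_neg (mul_ne_zero ha hj), div_eq_mul_inv, ENNReal.mul_inv (.inl ha) (.inl ha'),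
        mul_assoc, mul_assoc, ENNReal.inv_mul_cancel hj (hb j), mul_one]
  simp only [h]
  rw [← Finset.sum_mul, hsum, ENNReal.mul_inv_cancel ha ha']

theorem map_sum_sum_smul_restrict_prod [MeasurableSpace X] [MeasurableSpace Y] {Z : Type*}
    [MeasurableSpace Z] {ι κ : Type*} [Fintype ι] [Fintype κ] (ρ : Measure (X × Y)) {q : X × Y → Z}
    (hq : Measurable q) (w : ι → κ → ENNReal) (A : ι → Set X) (B : κ → Set Y) :
    (∑ i, ∑ j, w i j • ρ.restrict (A i ×ˢ B j)).map q
      = ∑ i, ∑ j, w i j • (ρ.restrict (A i ×ˢ B j)).map q := by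
  simp only [← Measure.mapₗ_apply_of_measurable hq, map_sum, map_smul]

theorem stmt7 {X Y : Type*}
    [MetricSpace X] [CompactSpace X] [PolishSpace X] [MeasurableSpace X] [BorelSpace X]
    [MetricSpace Y] [CompactSpace Y] [PolishSpace Y] [MeasurableSpace Y] [BorelSpace Y]
    (hdX : Metric.diam (Set.univ : Set X) ≤ 1) (hdY : Metric.diam (Set.univ : Set Y) ≤ 1)
    (μ : Measure X) (ν : Measure Y) [IsProbabilityMeasure μ] [IsProbabilityMeasure ν]
    (ε : ℝ) (hε : 0 < ε)
    -- an ε-partition of X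
    (k : ℕ) (XX : Fin k → Set X) (xp : Fin k → X)
    (hXXm : ∀ i, MeasurableSet (XX i))
    (hXXd : ∀ i i', i ≠ i' → Disjoint (XX i) (XX i'))
    (hXXu : (⋃ i, XX i) = Set.univ)
    (hxp : ∀ i, xp i ∈ XX i)
    (hXXb : ∀ i, XX i ⊆ Metric.ball (xp i) ε)
    -- an ε-partition of Y
    (l : ℕ) (YY : Fin l → Set Y) (yp : Fin l → Y)
    (hYYm : ∀ j, MeasurableSet (YY j))
    (hYYd : ∀ j j', j ≠ j' → Disjoint (YY j) (YY j'))
    (hYYu : (⋃ j, YY j) = Set.univ)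
    (hyp : ∀ j, yp j ∈ YY j)
    (hYYb : ∀ j, YY j ⊆ Metric.ball (yp j) ε)
    -- an atomic coupling of the ε-concentrations
    (πb : Measure (X × Y))
    (hπb : πb ∈ Couplings (∑ i : Fin k, μ (XX i) • Measure.dirac (xp i))
        (∑ j : Fin l, ν (YY j) • Measure.dirac (yp j))) :
    (∑ i : Fin k, ∑ j : Fin l,
        (if μ (XX i) * ν (YY j) = 0 then 0
          else πb {(xp i, yp j)} / (μ (XX i) * ν (YY j))) •
          ((μ.prod ν).restrict (XX i ×ˢ YY j)))
      ∈ Couplings μ ν := by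
  obtain ⟨-, hfst, hsnd⟩ := hπb
  have hxi := injective_of_mem_of_disjoint hXXd hxp
  have hyi := injective_of_mem_of_disjoint hYYd hyp
  have hμ : ∀ i, πb (Prod.fst ⁻¹' {xp i}) = μ (XX i) := fun i => by
    rw [← Measure.map_apply measurable_fst (measurableSet_singleton _), hfst]
    exact sum_smul_dirac_singleton hxi (fun i => μ (XX i)) i
  have hν : ∀ j, πb (Prod.snd ⁻¹' {yp j}) = ν (YY j) := fun j => by
    rw [← Measure.map_apply measurable_snd (measurableSet_singleton _), hsnd]
    exact sum_smul_dirac_singleton hyi (fun j => ν (YY j)) j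
  have hrow : ∀ i, ∑ j, πb {(xp i, yp j)} = μ (XX i) := fun i => by
    rw [← hμ i, ← sum_measure_inter_fiber πb measurable_snd hyi _ hsnd
      (measurable_fst (measurableSet_singleton _))]
    simp only [← Set.prod_eq, Set.singleton_prod_singleton]
  have hcol : ∀ j, ∑ i, πb {(xp i, yp j)} = ν (YY j) := fun j => by
    rw [← hν j, ← sum_measure_inter_fiber πb measurable_fst hxi _ hfst
      (measurable_snd (measurableSet_singleton _))]
    simp only [Set.inter_comm (Prod.snd ⁻¹' _), ← Set.prod_eq, Set.singleton_prod_singleton]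
  have hle_μ : ∀ i j, πb {(xp i, yp j)} ≤ μ (XX i) := fun i j =>
    hμ i ▸ measure_mono (by simp)
  have hle_ν : ∀ i j, πb {(xp i, yp j)} ≤ ν (YY j) := fun i j =>
    hν j ▸ measure_mono (by simp)
  have hmap_fst := map_sum_sum_smul_restrict_prod (μ.prod ν) measurable_fst
    (fun i j => if μ (XX i) * ν (YY j) = 0 then 0
      else πb {(xp i, yp j)} / (μ (XX i) * ν (YY j))) XX YY
  have hmap_snd := map_sum_sum_smul_restrict_prod (μ.prod ν) measurable_snd
    (fun i j => if μ (XX i) * ν (YY j) = 0 then 0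
      else πb {(xp i, yp j)} / (μ (XX i) * ν (YY j))) XX YY
  simp only [← Measure.prod_restrict, Measure.map_fst_prod, Measure.map_snd_prod,
    Measure.restrict_apply_univ, smul_smul] at hmap_fst hmap_snd
  simp only [← Finset.sum_smul] at hmap_fst
  conv_rhs at hmap_snd => rw [Finset.sum_comm]
  simp only [← Finset.sum_smul] at hmap_snd
  rw [sum_smul_restrict_eq μ hXXm hXXd hXXu fun i hi => sum_ite_div_mul_eq_one hi
    (measure_ne_top _ _) (fun j => measure_ne_top _ _) (hle_ν i) (hrow i)] at hmap_fst
  rw [sum_smul_restrict_eq ν hYYm hYYd hYYu fun j hj => by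
    simpa only [mul_comm (ν (YY j))] using sum_ite_div_mul_eq_one hj
      (measure_ne_top _ _) (fun i => measure_ne_top μ (XX i)) (fun i => hle_μ i j) (hcol j)]
    at hmap_snd
  simp only [Measure.prod_restrict] at hmap_fst hmap_snd
  refine ⟨⟨?_⟩, hmap_fst, hmap_snd⟩
  rw [← preimage_univ (f := Prod.fst), ← Measure.map_apply measurable_fst MeasurableSet.univ,
    hmap_fst, measure_univ]

end GWSOS
end

section
/- (Gluing Lemma for the SOS hierarchy) Let 𝕏 = (𝒳,d_𝒳,μ), 𝕐 = (𝒴,d_𝒴,ν) and ℤ = (𝒵,d_𝒵,κ) be compact metric measure spaces. Let P ∈ Π_r(μ,ν) and Q ∈ Π_r(ν,κ). Then there exists a Borel probability measure S on (𝒳×𝒴×𝒵)^{2r} such that (i) the marginal of S on (𝒳×𝒴)^{2r} (projecting each of the 2r triples to its 𝒳×𝒴 components) equals P, and the marginal of S on (𝒴×𝒵)^{2r} equals Q; and (ii) the marginal R := S|_{(𝒳×𝒵)^{2r}} belongs to Π_r(μ,κ). -/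
open MeasureTheory Metric Filter Set

namespace GWSOS

section

open ProbabilityTheory
open scoped Topology

/-- A sequence of discrete codes of the points of a measurable space that get finer and finer and
jointly generate the `σ`-algebra. -/
structure IsCode {Ω : Type*} [m : MeasurableSpace Ω] {C : ℕ → Type*} (c : ∀ n, Ω → C n) :
    Prop where
  mono : Monotone fun n => MeasurableSpace.comap (c n) ⊤
  iSup_eq : ⨆ n, MeasurableSpace.comap (c n) ⊤ = m

namespace IsCode

variable {Ω : Type*} [MeasurableSpace Ω] {C : ℕ → Type*} {c : ∀ n, Ω → C n}

lemma comap_le (hc : IsCode c) (n : ℕ) : MeasurableSpace.comap (c n) ⊤ ≤ ‹MeasurableSpace Ω› :=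
  hc.iSup_eq ▸ le_iSup (fun n => MeasurableSpace.comap (c n) ⊤) n

lemma measurableSet_preimage (hc : IsCode c) (n : ℕ) (T : Set (C n)) :
    MeasurableSet (c n ⁻¹' T) :=
  hc.comap_le n _ ⟨T, trivial, rfl⟩

lemma measurable_comp (hc : IsCode c) {E : Type*} [MeasurableSpace E] (n : ℕ) (F : C n → E) :
    Measurable fun ω => F (c n ω) :=
  fun T _ => hc.measurableSet_preimage n (F ⁻¹' T)

lemma prod (hc : IsCode c) {Ω' : Type*} [MeasurableSpace Ω'] {C' : ℕ → Type*}
    {c' : ∀ n, Ω' → C' n} (hc' : IsCode c') [∀ n, Countable (C n)] [∀ n, Countable (C' n)] :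
    IsCode fun n (ω : Ω × Ω') => (c n ω.1, c' n ω.2) := by
  have key : ∀ n, MeasurableSpace.comap (fun ω : Ω × Ω' => (c n ω.1, c' n ω.2)) ⊤ =
      (MeasurableSpace.comap (c n) ⊤).comap Prod.fst ⊔
        (MeasurableSpace.comap (c' n) ⊤).comap Prod.snd := by
    intro n
    let _ : MeasurableSpace (C n) := ⊤
    let _ : MeasurableSpace (C' n) := ⊤
    have : (⊤ : MeasurableSpace (C n × C' n)) = Prod.instMeasurableSpace :=
      (eq_top_iff.2 fun s _ => (Set.to_countable s).measurableSet).symm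
    rw [this, Prod.instMeasurableSpace, MeasurableSpace.prod, MeasurableSpace.comap_sup]
    simp only [MeasurableSpace.comap_comp]
    rfl
  constructor
  · simp only [key]
    exact fun i j hij => sup_le_sup (MeasurableSpace.comap_mono (hc.mono hij))
      (MeasurableSpace.comap_mono (hc'.mono hij))
  · simp only [key, iSup_sup_eq, ← MeasurableSpace.comap_iSup, hc.iSup_eq, hc'.iSup_eq]
    rfl

lemma pi (hc : IsCode c) (ι : Type*) [Finite ι] [∀ n, Countable (C n)] :
    IsCode fun n (ω : ι → Ω) (i : ι) => c n (ω i) := by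
  have key : ∀ n, MeasurableSpace.comap (fun (ω : ι → Ω) (i : ι) => c n (ω i)) ⊤ =
      ⨆ i, (MeasurableSpace.comap (c n) ⊤).comap fun ω : ι → Ω => ω i := by
    intro n
    let _ : MeasurableSpace (C n) := ⊤
    have : (⊤ : MeasurableSpace (ι → C n)) = MeasurableSpace.pi :=
      (eq_top_iff.2 fun s _ => (Set.to_countable s).measurableSet).symm
    rw [this, MeasurableSpace.pi, MeasurableSpace.comap_iSup]
    simp only [MeasurableSpace.comap_comp]
    rfl
  constructor
  · simp only [key]
    exact fun i j hij => iSup_mono fun s => MeasurableSpace.comap_mono (hc.mono hij)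
  · simp only [key]
    rw [iSup_comm]
    simp only [← MeasurableSpace.comap_iSup, hc.iSup_eq]
    rfl

end IsCode

/-- The first `n` bits of the canonical map to the Cantor space. -/
noncomputable def code (Ω : Type*) [MeasurableSpace Ω] [MeasurableSpace.CountablyGenerated Ω]
    (n : ℕ) (ω : Ω) (k : Fin n) : Bool :=
  MeasurableSpace.mapNatBool Ω ω k

lemma isCode_code (Ω : Type*) [m : MeasurableSpace Ω] [MeasurableSpace.CountablyGenerated Ω] :
    IsCode (code Ω) := by
  have hmeas (n : ℕ) : MeasurableSpace.comap (code Ω n) ⊤ ≤ m := by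
    rintro _ ⟨T, -, rfl⟩
    refine (measurable_pi_lambda _ fun k => ?_ : Measurable (code Ω n)) T.toFinite.measurableSet
    exact (measurable_pi_apply (k : ℕ)).comp (MeasurableSpace.measurable_mapNatBool Ω)
  refine ⟨fun i j hij => ?_, le_antisymm (iSup_le hmeas) ?_⟩
  · rintro _ ⟨T, -, rfl⟩
    exact ⟨(fun d k => d (Fin.castLE hij k)) ⁻¹' T, trivial, rfl⟩
  · conv_lhs => rw [← MeasurableSpace.generateFrom_natGeneratingSequence Ω]
    refine MeasurableSpace.generateFrom_le ?_
    rintro _ ⟨n, rfl⟩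
    refine le_iSup (fun n => MeasurableSpace.comap (code Ω n) ⊤) (n + 1) _
      ⟨{d | d (Fin.last n) = true}, trivial, ?_⟩
    ext ω
    simp [code, MeasurableSpace.mapNatBool]

/-- The average of `f` over the points with code `a`. -/
noncomputable def cellAvg {Ω C : Type*} [MeasurableSpace Ω] (μ : Measure Ω) (c : Ω → C)
    (f : Ω → ℝ) (a : C) : ℝ :=
  (∫ ω in c ⁻¹' {a}, f ω ∂μ) / μ.real (c ⁻¹' {a})

section cellAvg

variable {Ω : Type*} [MeasurableSpace Ω] {μ : Measure Ω}

lemma cellAvg_nonneg {C : Type*} {c : Ω → C} {f : Ω → ℝ} (hf : ∀ ω, 0 ≤ f ω) (a : C) :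
    0 ≤ cellAvg μ c f a :=
  div_nonneg (integral_nonneg hf) measureReal_nonneg

variable [IsFiniteMeasure μ]

lemma abs_cellAvg_le {C : Type*} {c : Ω → C} {f : Ω → ℝ} {M : ℝ} (hM : 0 ≤ M)
    (hf : ∀ ω, |f ω| ≤ M) (a : C) :
    |cellAvg μ c f a| ≤ M := by
  rw [cellAvg, abs_div, abs_of_nonneg measureReal_nonneg]
  refine div_le_of_le_mul₀ measureReal_nonneg hM ?_
  rw [← Real.norm_eq_abs]
  exact norm_setIntegral_le_of_norm_le_const (measure_lt_top _ _) fun ω _ =>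
    (Real.norm_eq_abs _).trans_le (hf ω)

lemma integral_comp_eq_sum {C : Type*} [Fintype C] {c : Ω → C}
    (hc : ∀ a, MeasurableSet (c ⁻¹' {a})) (F : C → ℝ) :
    ∫ ω, F (c ω) ∂μ = ∑ a, μ.real (c ⁻¹' {a}) * F a := by
  let _ : MeasurableSpace C := ⊤
  have hcm : Measurable c := measurable_to_countable' hc
  rw [← integral_map (f := F) hcm.aemeasurable (by fun_prop), integral_fintype (.of_finite)]
  simp [map_measureReal_apply hcm]

lemma setIntegral_cellAvg {C : Type*} [Finite C] {c : Ω → C}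
    (hc : ∀ a, MeasurableSet (c ⁻¹' {a})) {f : Ω → ℝ} (hf : Integrable f μ) (T : Set C) :
    ∫ ω in c ⁻¹' T, cellAvg μ c f (c ω) ∂μ = ∫ ω in c ⁻¹' T, f ω ∂μ := by
  classical
  have := Fintype.ofFinite C
  have hT : c ⁻¹' T = ⋃ a ∈ T.toFinset, c ⁻¹' {a} := by ext; simp
  have hd : (T.toFinset : Set C).PairwiseDisjoint fun a => c ⁻¹' {a} := fun a _ b _ hab =>
    Disjoint.preimage _ (by simpa using hab)
  have hcell (a : C) : EqOn (fun ω => cellAvg μ c f (c ω)) (fun _ => cellAvg μ c f a)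
      (c ⁻¹' {a}) := by
    rintro ω rfl; rfl
  rw [hT, integral_biUnion_finset _ (fun a _ => hc a) hd fun a _ => hf.integrableOn,
    integral_biUnion_finset _ (fun a _ => hc a) hd fun a _ =>
      (integrableOn_congr_fun (hcell a) (hc a)).2 (integrable_const _)]
  refine Finset.sum_congr rfl fun a _ => ?_
  rw [setIntegral_congr_fun (hc a) (hcell a), setIntegral_const, smul_eq_mul, cellAvg]
  rcases eq_or_ne (μ.real (c ⁻¹' {a})) 0 with h | h
  · rw [h, zero_mul, setIntegral_measure_zero]
    exact (measureReal_eq_zero_iff).1 h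
  · field_simp

lemma IsCode.tendsto_cellAvg {C : ℕ → Type*} [∀ n, Finite (C n)] {c : ∀ n, Ω → C n}
    (hc : IsCode c) {f : Ω → ℝ} (hfm : Measurable f) (hf : Integrable f μ) :
    ∀ᵐ ω ∂μ, Tendsto (fun n => cellAvg μ (c n) f (c n ω)) atTop (𝓝 (f ω)) := by
  let ℱ : Filtration ℕ ‹MeasurableSpace Ω› :=
    ⟨fun n => MeasurableSpace.comap (c n) ⊤, hc.mono, hc.comap_le⟩
  have hlim := hf.tendsto_ae_condExp (ℱ := ℱ) (by
    have : ⨆ n, ℱ n = ‹MeasurableSpace Ω› := hc.iSup_eq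
    rw [this]
    exact hfm.stronglyMeasurable)
  have heq : ∀ᵐ ω ∂μ, ∀ n, cellAvg μ (c n) f (c n ω) = (μ[f | ℱ n]) ω := by
    rw [ae_all_iff]
    intro n
    have hint : Integrable (fun ω => cellAvg μ (c n) f (c n ω)) μ := by
      let _ : MeasurableSpace (C n) := ⊤
      exact (Integrable.of_finite (μ := μ.map (c n))).comp_measurable
        (g := cellAvg μ (c n) f) (hc.measurable_comp n id)
    refine ae_eq_condExp_of_forall_setIntegral_eq (ℱ.le n) hf (fun s _ _ => hint.integrableOn) ?_ ?_
    · rintro _ ⟨T, -, rfl⟩ -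
      exact setIntegral_cellAvg (fun a => hc.measurableSet_preimage n _) hf T
    · refine (Measurable.stronglyMeasurable ?_).aestronglyMeasurable
      exact fun T _ => ⟨cellAvg μ (c n) f ⁻¹' T, trivial, rfl⟩
  filter_upwards [hlim, heq] with ω h1 h2
  simpa only [h2] using h1

end cellAvg

/-- Gluing of two measures along a common first marginal, conditionally independently given the
first coordinate, with the masses of rectangles as limits of discretizations. -/
lemma exists_gluing {Ω α β : Type*} [MeasurableSpace Ω] [MeasurableSpace α] [StandardBorelSpace α]
    [MeasurableSpace β] [StandardBorelSpace β] {C : ℕ → Type*} [∀ n, Fintype (C n)]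
    {c : ∀ n, Ω → C n} (hc : IsCode c) (lam : Measure Ω) [IsProbabilityMeasure lam]
    (P : Measure (Ω × α)) (Q : Measure (Ω × β)) (hP : P.fst = lam) (hQ : Q.fst = lam) :
    ∃ S : Measure (Ω × α × β), IsProbabilityMeasure S ∧
      S.map (fun w => (w.1, w.2.1)) = P ∧ S.map (fun w => (w.1, w.2.2)) = Q ∧
      ∀ A B, MeasurableSet A → MeasurableSet B →
        Tendsto (fun l => ∑ a : C l, P.real ((c l ⁻¹' {a}) ×ˢ A) * Q.real ((c l ⁻¹' {a}) ×ˢ B) /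
          lam.real (c l ⁻¹' {a})) atTop (𝓝 (S.real (univ ×ˢ A ×ˢ B))) := by
  have : IsProbabilityMeasure P := ⟨by rw [← Measure.fst_univ, hP]; exact measure_univ⟩
  have : IsProbabilityMeasure Q := ⟨by rw [← Measure.fst_univ, hQ]; exact measure_univ⟩
  have : Nonempty α := (nonempty_of_isProbabilityMeasure P).map Prod.snd
  have : Nonempty β := (nonempty_of_isProbabilityMeasure Q).map Prod.snd
  have hdP : lam ⊗ₘ P.condKernel = P := by rw [← hP]; exact P.disintegrate P.condKernel
  have hdQ : lam ⊗ₘ Q.condKernel = Q := by rw [← hQ]; exact Q.disintegrate Q.condKernel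
  have hSapply (D : Set Ω) (A : Set α) (B : Set β) (hD : MeasurableSet D) (hA : MeasurableSet A)
      (hB : MeasurableSet B) :
      (lam ⊗ₘ (P.condKernel ×ₖ Q.condKernel)) (D ×ˢ A ×ˢ B) =
        ∫⁻ y in D, P.condKernel y A * Q.condKernel y B ∂lam := by
    rw [Measure.compProd_apply_prod hD (hA.prod hB)]
    simp only [Kernel.prod_apply_prod]
  refine ⟨lam ⊗ₘ (P.condKernel ×ₖ Q.condKernel), inferInstance, ?_, ?_, fun A B hA hB => ?_⟩
  · refine Measure.ext_prod fun {D A} hD hA => ?_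
    rw [Measure.map_apply (by fun_prop) (hD.prod hA)]
    have : (fun w : Ω × α × β => (w.1, w.2.1)) ⁻¹' D ×ˢ A = D ×ˢ A ×ˢ univ := by
      ext; simp
    rw [this, hSapply D A univ hD hA .univ]
    conv_rhs => rw [← hdP, Measure.compProd_apply_prod hD hA]
    simp
  · refine Measure.ext_prod fun {D B} hD hB => ?_
    rw [Measure.map_apply (by fun_prop) (hD.prod hB)]
    have : (fun w : Ω × α × β => (w.1, w.2.2)) ⁻¹' D ×ˢ B = D ×ˢ univ ×ˢ B := by
      ext; simp
    rw [this, hSapply D univ B hD .univ hB]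
    conv_rhs => rw [← hdQ, Measure.compProd_apply_prod hD hB]
    simp
  · have hpm : Measurable fun y => (P.condKernel y).real A :=
      (Kernel.measurable_coe _ hA).ennreal_toReal
    have hqm : Measurable fun y => (Q.condKernel y).real B :=
      (Kernel.measurable_coe _ hB).ennreal_toReal
    have hpb (y : Ω) : |(P.condKernel y).real A| ≤ 1 := by
      rw [abs_of_nonneg measureReal_nonneg]; exact measureReal_le_one
    have hqb (y : Ω) : |(Q.condKernel y).real B| ≤ 1 := by
      rw [abs_of_nonneg measureReal_nonneg]; exact measureReal_le_one
    have hpi : Integrable (fun y => (P.condKernel y).real A) lam :=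
      .of_bound hpm.aestronglyMeasurable 1 (.of_forall hpb)
    have hqi : Integrable (fun y => (Q.condKernel y).real B) lam :=
      .of_bound hqm.aestronglyMeasurable 1 (.of_forall hqb)
    have hPset (D : Set Ω) (hD : MeasurableSet D) :
        ∫ y in D, (P.condKernel y).real A ∂lam = P.real (D ×ˢ A) := by
      conv_rhs => rw [← hdP, measureReal_def, Measure.compProd_apply_prod hD hA]
      rw [← integral_toReal (Kernel.measurable_coe _ hA).aemeasurable
        (.of_forall fun y => measure_lt_top _ _)]
      rfl
    have hQset (D : Set Ω) (hD : MeasurableSet D) :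
        ∫ y in D, (Q.condKernel y).real B ∂lam = Q.real (D ×ˢ B) := by
      conv_rhs => rw [← hdQ, measureReal_def, Measure.compProd_apply_prod hD hB]
      rw [← integral_toReal (Kernel.measurable_coe _ hB).aemeasurable
        (.of_forall fun y => measure_lt_top _ _)]
      rfl
    have hS : (lam ⊗ₘ (P.condKernel ×ₖ Q.condKernel)).real (univ ×ˢ A ×ˢ B) =
        ∫ y, (P.condKernel y).real A * (Q.condKernel y).real B ∂lam := by
      have hm : Measurable fun y => P.condKernel y A * Q.condKernel y B :=
        (Kernel.measurable_coe _ hA).mul (Kernel.measurable_coe _ hB)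
      rw [measureReal_def, hSapply univ A B .univ hA hB, Measure.restrict_univ,
        ← integral_toReal hm.aemeasurable
          (.of_forall fun y => ENNReal.mul_lt_top (measure_lt_top _ _) (measure_lt_top _ _))]
      simp only [ENNReal.toReal_mul]
      rfl
    have hsum (l : ℕ) : ∑ a : C l, P.real ((c l ⁻¹' {a}) ×ˢ A) * Q.real ((c l ⁻¹' {a}) ×ˢ B) /
        lam.real (c l ⁻¹' {a}) =
        ∫ y, cellAvg lam (c l) (fun y => (P.condKernel y).real A) (c l y) *
          cellAvg lam (c l) (fun y => (Q.condKernel y).real B) (c l y) ∂lam := by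
      rw [integral_comp_eq_sum (c := c l) (fun a => hc.measurableSet_preimage l _)
        (fun a => cellAvg lam (c l) (fun y => (P.condKernel y).real A) a *
          cellAvg lam (c l) (fun y => (Q.condKernel y).real B) a)]
      refine Finset.sum_congr rfl fun a _ => ?_
      simp only [cellAvg]
      rw [hPset _ (hc.measurableSet_preimage l _), hQset _ (hc.measurableSet_preimage l _)]
      rcases eq_or_ne (lam.real (c l ⁻¹' {a})) 0 with h | h
      · simp [h]
      · field_simp
    rw [hS]
    simp only [hsum]
    refine tendsto_integral_of_dominated_convergence (fun _ => (1 : ℝ)) (fun l => ?_)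
      (integrable_const _) (fun l => .of_forall fun y => ?_) ?_
    · exact (hc.measurable_comp l fun a => cellAvg lam (c l) (fun y => (P.condKernel y).real A) a *
          cellAvg lam (c l) (fun y => (Q.condKernel y).real B) a).aestronglyMeasurable
    · rw [Real.norm_eq_abs, abs_mul]
      exact mul_le_one₀ (abs_cellAvg_le zero_le_one hpb _) (abs_nonneg _)
        (abs_cellAvg_le zero_le_one hqb _)
    · filter_upwards [hc.tendsto_cellAvg hpm hpi, hc.tendsto_cellAvg hqm hqi] with y h1 h2
      exact h1.mul h2

section Glue

variable {ι X Y Z : Type*} [MeasurableSpace X] [MeasurableSpace Y] [MeasurableSpace Z]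

/-- The mass that a measure on families of pairs gives to the rectangle `A × C`, where `A` is a set
of families of first components and `C` a set of families of second components. -/
noncomputable def jointMass (P : Measure (ι → X × Y)) (A : Set (ι → X)) (C : Set (ι → Y)) : ℝ :=
  P.real {w | (fun s => (w s).1) ∈ A ∧ (fun s => (w s).2) ∈ C}

lemma measurableSet_joint {A : Set (ι → X)} {C : Set (ι → Y)} (hA : MeasurableSet A)
    (hC : MeasurableSet C) :
    MeasurableSet {w : ι → X × Y | (fun s => (w s).1) ∈ A ∧ (fun s => (w s).2) ∈ C} :=
  ((by fun_prop : Measurable fun (w : ι → X × Y) s => (w s).1) hA).inter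
    ((by fun_prop : Measurable fun (w : ι → X × Y) s => (w s).2) hC)

lemma ext_jointMass {P P' : Measure (ι → X × Y)} [IsFiniteMeasure P] [IsFiniteMeasure P']
    (h : ∀ A C, MeasurableSet A → MeasurableSet C → jointMass P A C = jointMass P' A C) :
    P = P' := by
  have hu : Measurable fun w : ι → X × Y => (fun s => (w s).1, fun s => (w s).2) := by fun_prop
  have hz : Measurable fun (p : (ι → X) × (ι → Y)) s => (p.1 s, p.2 s) := by fun_prop
  have key : P.map (fun w => (fun s => (w s).1, fun s => (w s).2)) =
      P'.map (fun w => (fun s => (w s).1, fun s => (w s).2)) := by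
    refine Measure.ext_prod fun {A C} hA hC => ?_
    rw [Measure.map_apply hu (hA.prod hC), Measure.map_apply hu (hA.prod hC),
      ← measureReal_eq_measureReal_iff]
    exact h A C hA hC
  have := congrArg (Measure.map fun (p : (ι → X) × (ι → Y)) s => (p.1 s, p.2 s)) key
  rw [Measure.map_map hz hu, Measure.map_map hz hu] at this
  simpa only [Function.comp_def, Prod.mk.eta, Measure.map_id'] using this

lemma measurable_comp_perm (σ : Equiv.Perm ι) : Measurable fun z : ι → X => z ∘ σ :=
  measurable_pi_lambda _ fun s => measurable_pi_apply (σ s)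

lemma jointMass_map_perm (σ : Equiv.Perm ι) (P : Measure (ι → X × Y)) {A : Set (ι → X)}
    {C : Set (ι → Y)} (hA : MeasurableSet A) (hC : MeasurableSet C) :
    jointMass (P.map fun z => z ∘ σ) A C =
      jointMass P ((fun z => z ∘ σ) ⁻¹' A) ((fun z => z ∘ σ) ⁻¹' C) := by
  rw [jointMass, map_measureReal_apply (measurable_comp_perm σ) (measurableSet_joint hA hC),
    jointMass]
  rfl

section

variable [MeasurableSpace.CountablyGenerated Y]

/-- The families whose members have prescribed codes. -/
def cell (l : ℕ) (a : ι → Fin l → Bool) : Set (ι → Y) :=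
  (fun (y : ι → Y) s => code Y l (y s)) ⁻¹' {a}

lemma mem_cell {l : ℕ} {a : ι → Fin l → Bool} {y : ι → Y} :
    y ∈ cell l a ↔ ∀ s, code Y l (y s) = a s := by
  simp [cell, funext_iff]

variable [Fintype ι]

lemma measurableSet_cell (l : ℕ) (a : ι → Fin l → Bool) : MeasurableSet (cell l a : Set (ι → Y)) :=
  ((isCode_code Y).pi ι).measurableSet_preimage l _

lemma pi_real_cell (ν : Measure Y) [SigmaFinite ν] (l : ℕ) (a : ι → Fin l → Bool) :
    (Measure.pi fun _ : ι => ν).real (cell l a) = ∏ s, ν.real (code Y l ⁻¹' {a s}) := by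
  have : (cell l a : Set (ι → Y)) = univ.pi fun s => code Y l ⁻¹' {a s} := by
    ext y; simp [mem_cell]
  rw [this, measureReal_def, Measure.pi_pi, ENNReal.toReal_prod]
  rfl

variable [DecidableEq ι]

/-- `R` is the composition of `P` and `Q` along the second components of their pairs, as a limit of
compositions along finer and finer discretizations of `Y`. -/
def IsGlue (ν : Measure Y) (P : Measure (ι → X × Y)) (Q : Measure (ι → Z × Y))
    (R : Measure (ι → X × Z)) : Prop :=
  ∀ A B, MeasurableSet A → MeasurableSet B →
    Tendsto (fun l => ∑ a : ι → Fin l → Bool, jointMass P A (cell l a) * jointMass Q B (cell l a) /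
      ∏ s, ν.real (code Y l ⁻¹' {a s})) atTop (𝓝 (jointMass R A B))

lemma IsGlue.swap {ν : Measure Y} {P : Measure (ι → X × Y)} {Q : Measure (ι → Z × Y)}
    {R : Measure (ι → X × Z)} (h : IsGlue ν P Q R) :
    IsGlue ν Q P (R.map fun w s => (w s).swap) := by
  intro B A hB hA
  have : jointMass (R.map fun w s => (w s).swap) B A = jointMass R A B := by
    rw [jointMass, map_measureReal_apply (by fun_prop) (measurableSet_joint hB hA), jointMass]
    congr 1
    ext w
    simp [and_comm]
  rw [this]
  simpa only [mul_comm] using h A B hA hB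

lemma exists_isGlue [StandardBorelSpace X] [StandardBorelSpace Z]
    (ν : Measure Y) [IsProbabilityMeasure ν]
    (P : Measure (ι → X × Y)) (Q : Measure (ι → Y × Z))
    (hP : P.map (fun w s => (w s).2) = Measure.pi fun _ => ν)
    (hQ : Q.map (fun w s => (w s).1) = Measure.pi fun _ => ν) :
    ∃ S : Measure (ι → X × Y × Z), IsProbabilityMeasure S ∧
      S.map (fun z s => ((z s).1, (z s).2.1)) = P ∧
      S.map (fun z s => ((z s).2.1, (z s).2.2)) = Q ∧
      IsGlue ν P (Q.map fun w s => (w s).swap) (S.map fun z s => ((z s).1, (z s).2.2)) := by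
  have huP : Measurable fun w : ι → X × Y => (fun s => (w s).2, fun s => (w s).1) := by fun_prop
  have huQ : Measurable fun w : ι → Y × Z => (fun s => (w s).1, fun s => (w s).2) := by fun_prop
  obtain ⟨S, hS, hSP, hSQ, hlim⟩ := exists_gluing ((isCode_code Y).pi ι) (Measure.pi fun _ => ν)
    (P.map fun w => (fun s => (w s).2, fun s => (w s).1))
    (Q.map fun w => (fun s => (w s).1, fun s => (w s).2))
    (by rw [Measure.fst, Measure.map_map measurable_fst huP]; exact hP)
    (by rw [Measure.fst, Measure.map_map measurable_fst huQ]; exact hQ)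
  have hz : Measurable fun (p : (ι → Y) × (ι → X) × (ι → Z)) s => (p.2.1 s, p.1 s, p.2.2 s) := by
    fun_prop
  refine ⟨S.map fun p s => (p.2.1 s, p.1 s, p.2.2 s), Measure.isProbabilityMeasure_map
    hz.aemeasurable, ?_, ?_, fun A B hA hB => ?_⟩
  · have := congrArg (Measure.map fun (p : (ι → Y) × (ι → X)) s => (p.2 s, p.1 s)) hSP
    rw [Measure.map_map (by fun_prop) (by fun_prop), Measure.map_map (by fun_prop) huP] at this
    rw [Measure.map_map (by fun_prop) hz]
    simpa only [Function.comp_def, Prod.mk.eta, Measure.map_id'] using this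
  · have := congrArg (Measure.map fun (p : (ι → Y) × (ι → Z)) s => (p.1 s, p.2 s)) hSQ
    rw [Measure.map_map (by fun_prop) (by fun_prop), Measure.map_map (by fun_prop) huQ] at this
    rw [Measure.map_map (by fun_prop) hz]
    simpa only [Function.comp_def, Prod.mk.eta, Measure.map_id'] using this
  · convert hlim A B hA hB using 1
    · funext l
      refine Finset.sum_congr rfl fun a _ => ?_
      have hcell : MeasurableSet (cell l a : Set (ι → Y)) := measurableSet_cell l a
      congr 1
      · congr 1
        · refine Eq.trans ?_ (map_measureReal_apply huP (hcell.prod hA)).symm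
          rw [jointMass]; congr 1; ext w; exact and_comm
        · refine Eq.trans ?_ (map_measureReal_apply huQ (hcell.prod hB)).symm
          rw [jointMass, map_measureReal_apply (by fun_prop) (measurableSet_joint hB hcell)]
          congr 1; ext w; exact and_comm
      · exact (pi_real_cell ν l a).symm
    · rw [jointMass, Measure.map_map (by fun_prop) hz,
        map_measureReal_apply (by fun_prop) (measurableSet_joint hA hB)]
      congr 2
      ext w
      simp

/-- Permutation invariance passes to compositions. -/
lemma IsGlue.map_perm {ν : Measure Y} {P : Measure (ι → X × Y)} {Q : Measure (ι → Z × Y)}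
    {R : Measure (ι → X × Z)} [IsFiniteMeasure R] (h : IsGlue ν P Q R) (σ : Equiv.Perm ι)
    (hP : P.map (fun z => z ∘ σ) = P) (hQ : Q.map (fun z => z ∘ σ) = Q) :
    R.map (fun z => z ∘ σ) = R := by
  have hcell (l : ℕ) (a : ι → Fin l → Bool) :
      (fun z : ι → Y => z ∘ σ) ⁻¹' cell l (a ∘ σ) = cell l a := by
    ext y
    simp only [mem_preimage, mem_cell, Function.comp_apply]
    exact σ.forall_congr_right (q := fun s => code Y l (y s) = a s)
  refine ext_jointMass fun A B hA hB => ?_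
  rw [jointMass_map_perm σ R hA hB]
  refine tendsto_nhds_unique (h _ _ (measurable_comp_perm σ hA)
    (measurable_comp_perm σ hB)) ((h A B hA hB).congr fun l => ?_)
  refine (Fintype.sum_equiv (Equiv.arrowCongr σ.symm (Equiv.refl _)) _ _ fun a => ?_).symm
  have ha : (Equiv.arrowCongr σ.symm (Equiv.refl (Fin l → Bool))) a = a ∘ σ := rfl
  have e1 := jointMass_map_perm σ P hA (measurableSet_cell (Y := Y) l (a ∘ σ))
  have e2 := jointMass_map_perm σ Q hB (measurableSet_cell (Y := Y) l (a ∘ σ))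
  rw [hP, hcell] at e1
  rw [hQ, hcell] at e2
  rw [ha, e1, e2]
  congr 1
  exact (Equiv.prod_comp σ fun s => ν.real (code Y l ⁻¹' {a s})).symm

end

end Glue

section Marginals

variable {ι X Y Z : Type*} [MeasurableSpace X] [MeasurableSpace Y] [MeasurableSpace Z]

/-- Under `P`, the image under `φ` of the coordinate `i` has law `μ` and is independent of the other
coordinates. -/
def CoordIndep {V E : Type*} [MeasurableSpace V] [MeasurableSpace E] (P : Measure (ι → V)) (i : ι)
    (φ : V → E) (μ : Measure E) : Prop :=
  P.map (fun z => (φ (z i), fun j : {j : ι // j ≠ i} => z j.1)) =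
    μ.prod (P.map (fun z (j : {j : ι // j ≠ i}) => z j.1))

lemma CoordIndep.measureReal_eq {V E : Type*} [MeasurableSpace V] [MeasurableSpace E]
    {P : Measure (ι → V)} [IsFiniteMeasure P] {i : ι} {φ : V → E} {μ : Measure E}
    (h : CoordIndep P i φ μ) (hφ : Measurable φ) {s : Set E} (hs : MeasurableSet s)
    {D : Set ({j : ι // j ≠ i} → V)} (hD : MeasurableSet D) :
    P.real {w | φ (w i) ∈ s ∧ (fun j : {j : ι // j ≠ i} => w j.1) ∈ D} =
      μ.real s * P.real {w | (fun j : {j : ι // j ≠ i} => w j.1) ∈ D} := by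
  have hm : Measurable fun z : ι → V => (φ (z i), fun j : {j : ι // j ≠ i} => z j.1) := by fun_prop
  have := congrArg (fun T => T.real (s ×ˢ D)) h
  simp only [measureReal_prod_prod] at this
  rw [map_measureReal_apply hm (hs.prod hD), map_measureReal_apply (by fun_prop) hD] at this
  exact this

lemma map_eq_pi_of_coordIndep [Fintype ι] {V E : Type*} [MeasurableSpace V] [MeasurableSpace E]
    {P : Measure (ι → V)} [IsProbabilityMeasure P] {φ : V → E} (hφ : Measurable φ) {μ : Measure E}
    [IsProbabilityMeasure μ] (h : ∀ i, CoordIndep P i φ μ) :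
    P.map (fun w s => φ (w s)) = Measure.pi fun _ => μ := by
  classical
  symm
  refine Measure.pi_eq fun A hA => ?_
  have key (T : Finset ι) : P.real {w | ∀ s ∈ T, φ (w s) ∈ A s} = ∏ s ∈ T, μ.real (A s) := by
    induction T using Finset.induction_on with
    | empty => simp
    | insert i T hi ih =>
      have hset : {w : ι → V | ∀ s ∈ T, φ (w s) ∈ A s} =
          {w | (fun j : {j : ι // j ≠ i} => w j.1) ∈
            {v : {j : ι // j ≠ i} → V | ∀ j : {j : ι // j ≠ i}, j.1 ∈ T → φ (v j) ∈ A j}} := by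
        ext w
        simp only [mem_ofPred_eq]
        exact ⟨fun hw j hj => hw j hj, fun hw s hs => hw ⟨s, fun e => hi (e ▸ hs)⟩ hs⟩
      have hD : MeasurableSet
          {v : {j : ι // j ≠ i} → V | ∀ j : {j : ι // j ≠ i}, j.1 ∈ T → φ (v j) ∈ A j} := by
        simp only [ofPred_forall]
        exact .iInter fun j => .iInter fun _ => (hφ.comp (measurable_pi_apply j)) (hA j)
      rw [Finset.prod_insert hi, ← ih, hset, ← (h i).measureReal_eq hφ (hA i) hD]
      congr 1
      ext w
      have := Set.ext_iff.1 hset w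
      simp only [mem_ofPred_eq] at this
      simp [this]
  rw [Measure.map_apply (by fun_prop) (.univ_pi hA)]
  have := key Finset.univ
  simp only [measureReal_def, ← ENNReal.toReal_prod] at this
  rw [ENNReal.toReal_eq_toReal_iff' (measure_ne_top _ _)
    (ENNReal.prod_ne_top fun _ _ => measure_ne_top _ _)] at this
  rw [← this]
  congr 1
  ext w
  simp

lemma sum_measureReal_inter_preimage {Ω C : Type*} [MeasurableSpace Ω] {P : Measure Ω}
    [IsFiniteMeasure P] [Fintype C] {c : Ω → C} (hc : ∀ a, MeasurableSet (c ⁻¹' {a})) (T : Set Ω) :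
    ∑ a, P.real (c ⁻¹' {a} ∩ T) = P.real T := by
  have := integral_comp_eq_sum (μ := P.restrict T) hc fun _ => 1
  simpa [measureReal_restrict_apply, hc] using this.symm

variable [Fintype ι] [DecidableEq ι] [MeasurableSpace.CountablyGenerated Y]

/-- The discretized composition factorizes over the coordinate `i`. -/
lemma sum_cell_eq_mul {μ : Measure X} {ν : Measure Y} [IsProbabilityMeasure μ]
    [IsProbabilityMeasure ν]
    {P : Measure (ι → X × Y)} {Q : Measure (ι → Z × Y)} [IsProbabilityMeasure P]
    [IsProbabilityMeasure Q] (i : ι)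
    (hPX : CoordIndep P i Prod.fst μ) (hPY : CoordIndep P i Prod.snd ν)
    (hQY : CoordIndep Q i Prod.snd ν)
    {A₀ : Set X} (hA₀ : MeasurableSet A₀) {A : Set ({j : ι // j ≠ i} → X)} (hA : MeasurableSet A)
    {B : Set ({j : ι // j ≠ i} → Z)} (hB : MeasurableSet B) (l : ℕ) :
    ∑ a : ι → Fin l → Bool,
      jointMass P {x | x i ∈ A₀ ∧ (fun j : {j : ι // j ≠ i} => x j.1) ∈ A} (cell l a) *
      jointMass Q {z | (fun j : {j : ι // j ≠ i} => z j.1) ∈ B} (cell l a) /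
        ∏ s, ν.real (code Y l ⁻¹' {a s}) =
    μ.real A₀ * ∑ a : {j : ι // j ≠ i} → Fin l → Bool,
      P.real {w | (fun j : {j : ι // j ≠ i} => w j.1) ∈
        {v : {j : ι // j ≠ i} → X × Y | (fun j => (v j).1) ∈ A ∧ (fun j => (v j).2) ∈ cell l a}} *
      Q.real {w | (fun j : {j : ι // j ≠ i} => w j.1) ∈
        {v : {j : ι // j ≠ i} → Z × Y | (fun j => (v j).1) ∈ B ∧ (fun j => (v j).2) ∈ cell l a}} /
        ∏ j, ν.real (code Y l ⁻¹' {a j}) := by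
  have hcode (b : Fin l → Bool) : MeasurableSet (code Y l ⁻¹' {b}) :=
    (isCode_code Y).measurableSet_preimage l _
  let e := Equiv.funSplitAt i (Fin l → Bool)
  have he (b : Fin l → Bool) (a : {j : ι // j ≠ i} → Fin l → Bool) :
      e.symm (b, a) i = b ∧ ∀ j : {j : ι // j ≠ i}, e.symm (b, a) j = a j := by
    have := e.apply_symm_apply (b, a)
    exact ⟨congrArg Prod.fst this, fun j => congrFun (congrArg Prod.snd this) j⟩
  have hcell (b : Fin l → Bool) (a : {j : ι // j ≠ i} → Fin l → Bool) (y : ι → Y) :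
      y ∈ cell l (e.symm (b, a)) ↔
        y i ∈ code Y l ⁻¹' {b} ∧ (fun j : {j : ι // j ≠ i} => y j.1) ∈ cell l a := by
    simp only [mem_cell, mem_preimage, mem_singleton_iff]
    constructor
    · intro hy
      exact ⟨(hy i).trans (he b a).1, fun j => (hy j).trans ((he b a).2 j)⟩
    · rintro ⟨h1, h2⟩ s
      by_cases hs : s = i
      · subst hs; exact h1.trans (he b a).1.symm
      · exact (h2 ⟨s, hs⟩).trans ((he b a).2 ⟨s, hs⟩).symm
  rw [← e.symm.sum_comp, Fintype.sum_prod_type, Finset.sum_comm, Finset.mul_sum]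
  refine Finset.sum_congr rfl fun a _ => ?_
  have hD := measurableSet_joint hA (measurableSet_cell (Y := Y) l a)
  have hE := measurableSet_joint hB (measurableSet_cell (Y := Y) l a)
  set D := {v : {j : ι // j ≠ i} → X × Y | (fun j => (v j).1) ∈ A ∧ (fun j => (v j).2) ∈ cell l a}
  set E := {v : {j : ι // j ≠ i} → Z × Y | (fun j => (v j).1) ∈ B ∧ (fun j => (v j).2) ∈ cell l a}
  have hterm (b : Fin l → Bool) :
      jointMass P {x | x i ∈ A₀ ∧ (fun j : {j : ι // j ≠ i} => x j.1) ∈ A}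
          (cell l (e.symm (b, a))) *
        jointMass Q {z | (fun j : {j : ι // j ≠ i} => z j.1) ∈ B} (cell l (e.symm (b, a))) /
        ∏ s, ν.real (code Y l ⁻¹' {e.symm (b, a) s}) =
      P.real ((fun w => code Y l (w i).2) ⁻¹' {b} ∩
        {w | (w i).1 ∈ A₀ ∧ (fun j : {j : ι // j ≠ i} => w j.1) ∈ D}) *
        (Q.real {w | (fun j : {j : ι // j ≠ i} => w j.1) ∈ E} /
          ∏ j, ν.real (code Y l ⁻¹' {a j})) := by
    have h1 : jointMass P {x | x i ∈ A₀ ∧ (fun j : {j : ι // j ≠ i} => x j.1) ∈ A}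
        (cell l (e.symm (b, a))) = P.real ((fun w => code Y l (w i).2) ⁻¹' {b} ∩
        {w | (w i).1 ∈ A₀ ∧ (fun j : {j : ι // j ≠ i} => w j.1) ∈ D}) := by
      rw [jointMass]
      congr 1
      ext w
      simp only [hcell, D, mem_ofPred_eq, mem_inter_iff, mem_preimage, mem_singleton_iff]
      tauto
    have h2 : jointMass Q {z | (fun j : {j : ι // j ≠ i} => z j.1) ∈ B}
        (cell l (e.symm (b, a))) = ν.real (code Y l ⁻¹' {b}) *
          Q.real {w | (fun j : {j : ι // j ≠ i} => w j.1) ∈ E} := by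
      rw [← hQY.measureReal_eq measurable_snd (hcode b) hE, jointMass]
      congr 1
      ext w
      simp only [hcell, E, mem_ofPred_eq, mem_preimage, mem_singleton_iff]
      tauto
    have h3 : ∏ s, ν.real (code Y l ⁻¹' {e.symm (b, a) s}) =
        ν.real (code Y l ⁻¹' {b}) * ∏ j, ν.real (code Y l ⁻¹' {a j}) := by
      rw [Fintype.prod_eq_mul_prod_subtype_ne _ i, (he b a).1]
      simp only [(he b a).2]
    rw [h1, h2, h3]
    rcases eq_or_ne (ν.real (code Y l ⁻¹' {b})) 0 with h0 | h0
    · have : P.real ((fun w => code Y l (w i).2) ⁻¹' {b} ∩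
          {w | (w i).1 ∈ A₀ ∧ (fun j : {j : ι // j ≠ i} => w j.1) ∈ D}) = 0 := by
        refine le_antisymm ?_ measureReal_nonneg
        have := hPY.measureReal_eq measurable_snd (hcode b) MeasurableSet.univ
        rw [h0, zero_mul] at this
        rw [← this]
        exact measureReal_mono fun w hw => ⟨hw.1, trivial⟩
      simp [this]
    · rw [mul_left_comm, mul_div_mul_left _ _ h0, mul_div_assoc]
  simp only [hterm]
  rw [← Finset.sum_mul, sum_measureReal_inter_preimage
    (c := fun w : ι → X × Y => code Y l (w i).2)
    (fun b => (by fun_prop : Measurable fun w : ι → X × Y => (w i).2) (hcode b)),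
    hPX.measureReal_eq measurable_fst hA₀ hD]
  ring

/-- Independence of the coordinate `i` passes to compositions. -/
lemma IsGlue.coordIndep_fst {μ : Measure X} {ν : Measure Y} [IsProbabilityMeasure μ]
    [IsProbabilityMeasure ν]
    {P : Measure (ι → X × Y)} {Q : Measure (ι → Z × Y)} [IsProbabilityMeasure P]
    [IsProbabilityMeasure Q] {R : Measure (ι → X × Z)} [IsProbabilityMeasure R]
    (h : IsGlue ν P Q R) (i : ι)
    (hPX : CoordIndep P i Prod.fst μ) (hPY : CoordIndep P i Prod.snd ν)
    (hQY : CoordIndep Q i Prod.snd ν) :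
    CoordIndep R i Prod.fst μ := by
  have hfact {A₀ : Set X} (hA₀ : MeasurableSet A₀) {A : Set ({j : ι // j ≠ i} → X)}
      (hA : MeasurableSet A) {B : Set ({j : ι // j ≠ i} → Z)} (hB : MeasurableSet B) :
      jointMass R {x | x i ∈ A₀ ∧ (fun j : {j : ι // j ≠ i} => x j.1) ∈ A}
        {z | (fun j : {j : ι // j ≠ i} => z j.1) ∈ B} =
      μ.real A₀ * jointMass R {x | x i ∈ univ ∧ (fun j : {j : ι // j ≠ i} => x j.1) ∈ A}
        {z | (fun j : {j : ι // j ≠ i} => z j.1) ∈ B} := by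
    have hmA {A₀ : Set X} (hA₀ : MeasurableSet A₀) :
        MeasurableSet {x : ι → X | x i ∈ A₀ ∧ (fun j : {j : ι // j ≠ i} => x j.1) ∈ A} :=
      (measurable_pi_apply i hA₀).inter
        ((by fun_prop : Measurable fun (x : ι → X) (j : {j : ι // j ≠ i}) => x j.1) hA)
    have hmB : MeasurableSet {z : ι → Z | (fun j : {j : ι // j ≠ i} => z j.1) ∈ B} :=
      (by fun_prop : Measurable fun (x : ι → Z) (j : {j : ι // j ≠ i}) => x j.1) hB
    refine tendsto_nhds_unique (h _ _ (hmA hA₀) hmB)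
      (((h _ _ (hmA .univ) hmB).const_mul (μ.real A₀)).congr fun l => ?_)
    rw [sum_cell_eq_mul i hPX hPY hQY .univ hA hB, sum_cell_eq_mul i hPX hPY hQY hA₀ hA hB,
      probReal_univ, one_mul]
  have hu : Measurable fun p : X × ({j : ι // j ≠ i} → X × Z) =>
      (p.1, (fun j => (p.2 j).1), fun j => (p.2 j).2) := by fun_prop
  have hz : Measurable fun p : X × ({j : ι // j ≠ i} → X) × ({j : ι // j ≠ i} → Z) =>
      (p.1, fun j => (p.2.1 j, p.2.2 j)) := by fun_prop
  have hm : Measurable fun z : ι → X × Z => ((z i).1, fun j : {j : ι // j ≠ i} => z j.1) := by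
    fun_prop
  have hr : Measurable fun (z : ι → X × Z) (j : {j : ι // j ≠ i}) => z j.1 := by fun_prop
  have : IsProbabilityMeasure (R.map fun (z : ι → X × Z) (j : {j : ι // j ≠ i}) => z j.1) :=
    Measure.isProbabilityMeasure_map hr.aemeasurable
  have : IsProbabilityMeasure
      (R.map fun z : ι → X × Z => ((z i).1, fun j : {j : ι // j ≠ i} => z j.1)) :=
    Measure.isProbabilityMeasure_map hm.aemeasurable
  have key : (R.map fun z => ((z i).1, fun j : {j : ι // j ≠ i} => z j.1)).map (fun p =>
        (p.1, (fun j => (p.2 j).1), fun j => (p.2 j).2)) =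
      (μ.prod (R.map fun z (j : {j : ι // j ≠ i}) => z j.1)).map (fun p =>
        (p.1, (fun j => (p.2 j).1), fun j => (p.2 j).2)) := by
    refine Measure.ext_prod₃ fun {A₀ A B} hA₀ hA hB => ?_
    rw [← measureReal_eq_measureReal_iff, map_measureReal_apply hu (hA₀.prod (hA.prod hB)),
      map_measureReal_apply hu (hA₀.prod (hA.prod hB)),
      map_measureReal_apply hm (hu (hA₀.prod (hA.prod hB)))]
    have hpre : (fun p : X × ({j : ι // j ≠ i} → X × Z) =>
        (p.1, (fun j => (p.2 j).1), fun j => (p.2 j).2)) ⁻¹' A₀ ×ˢ A ×ˢ B =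
        A₀ ×ˢ {v | (fun j => (v j).1) ∈ A ∧ (fun j => (v j).2) ∈ B} := by
      ext; simp
    rw [hpre, measureReal_prod_prod, map_measureReal_apply hr (measurableSet_joint hA hB)]
    convert hfact hA₀ hA hB using 1
    · rw [jointMass]; congr 1; ext w; simp [and_assoc]
    · rw [jointMass]; congr 2; ext w; simp
  have := congrArg (Measure.map fun p : X × ({j : ι // j ≠ i} → X) × ({j : ι // j ≠ i} → Z) =>
      (p.1, fun j => (p.2.1 j, p.2.2 j))) key
  rw [Measure.map_map hz hu, Measure.map_map hz hu] at this
  simp only [Function.comp_def, Prod.mk.eta, Measure.map_id'] at this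
  exact this

end Marginals

section PSD

variable {ι κ τ : Type*}

/-- The positivity condition for the blocks of coordinates given by `e`. -/
def PSDOn {V : Type*} [MeasurableSpace V] (e : κ ⊕ κ ⊕ τ ≃ ι) (P : Measure (ι → V)) : Prop :=
  ∀ (f : (κ → V) → ℝ) (g : (τ → V) → ℝ), Measurable f → (∃ M, ∀ w, |f w| ≤ M) →
    Measurable g → (∃ M, ∀ w, |g w| ≤ M) → (∀ w, 0 ≤ g w) →
    0 ≤ ∫ z, (f fun s => z (e (.inl s))) * (f fun s => z (e (.inr (.inl s)))) *
      (g fun s => z (e (.inr (.inr s)))) ∂P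

lemma measurable_block_s9 {V : Type*} [MeasurableSpace V] {ρ : Type*} (j : ρ → ι) :
    Measurable fun (z : ι → V) s => z (j s) := by
  fun_prop

lemma posSemidef_of_psdOn {V : Type*} [MeasurableSpace V] {e : κ ⊕ κ ⊕ τ ≃ ι} {P : Measure (ι → V)}
    [IsFiniteMeasure P] (hpsd : PSDOn e P) (hsym : ∀ σ : Equiv.Perm ι, P.map (fun z => z ∘ σ) = P)
    {U : Type*} [Finite U] {u : (κ → V) → U} (hu : ∀ a, MeasurableSet (u ⁻¹' {a}))
    {T : Set (τ → V)} (hT : MeasurableSet T) :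
    (Matrix.of fun a b => P.real {z | u (fun s => z (e (.inl s))) = a ∧
      u (fun s => z (e (.inr (.inl s)))) = b ∧
      (fun s => z (e (.inr (.inr s)))) ∈ T}).PosSemidef := by
  have := Fintype.ofFinite U
  have hm1 (a : U) : MeasurableSet {z : ι → V | u (fun s => z (e (.inl s))) = a} :=
    measurable_block_s9 (fun s => e (.inl s)) (hu a)
  have hm2 (a : U) : MeasurableSet {z : ι → V | u (fun s => z (e (.inr (.inl s)))) = a} :=
    measurable_block_s9 (fun s => e (.inr (.inl s))) (hu a)
  have hm3 : MeasurableSet {z : ι → V | (fun s => z (e (.inr (.inr s)))) ∈ T} :=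
    measurable_block_s9 (fun s => e (.inr (.inr s))) hT
  refine .of_dotProduct_mulVec_nonneg (Matrix.IsHermitian.ext fun a b => ?_) fun x => ?_
  · let σ₀ : Equiv.Perm (κ ⊕ κ ⊕ τ) := (Equiv.sumAssoc κ κ τ).symm.trans
      (((Equiv.sumComm κ κ).sumCongr (Equiv.refl τ)).trans (Equiv.sumAssoc κ κ τ))
    simp only [Matrix.of_apply, star_trivial]
    conv_rhs => rw [← hsym (e.permCongr σ₀)]
    refine Eq.trans ?_ (map_measureReal_apply (measurable_comp_perm _)
      ((hm1 a).inter ((hm2 b).inter hm3))).symm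
    congr 1
    ext z
    simp [σ₀, Equiv.permCongr_apply, and_left_comm]
  · have huc : Measurable fun w => x (u w) := by
      let _ : MeasurableSpace U := ⊤
      exact (measurable_from_top (f := x)).comp (measurable_to_countable' hu)
    have h := hpsd (fun w => x (u w)) (T.indicator 1) huc
      ⟨∑ a, |x a|, fun w => Finset.single_le_sum (f := fun a => |x a|) (fun _ _ => abs_nonneg _)
        (Finset.mem_univ (u w))⟩ (measurable_one.indicator hT)
      ⟨1, fun w => by by_cases hw : w ∈ T <;> simp [hw]⟩
      (fun w => indicator_nonneg (fun _ _ => zero_le_one) w)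
    have hint : ∀ z : ι → V, x (u fun s => z (e (.inl s))) * x (u fun s => z (e (.inr (.inl s)))) *
        T.indicator 1 (fun s => z (e (.inr (.inr s)))) =
        {z : ι → V | (fun s => z (e (.inr (.inr s)))) ∈ T}.indicator (fun z =>
          x (u fun s => z (e (.inl s))) * x (u fun s => z (e (.inr (.inl s))))) z := by
      intro z
      by_cases hz : (fun s => z (e (.inr (.inr s)))) ∈ T <;> simp [hz]
    simp only [hint] at h
    rw [integral_indicator hm3, integral_comp_eq_sum
      (c := fun z : ι → V => (u fun s => z (e (.inl s)), u fun s => z (e (.inr (.inl s)))))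
      (fun p => by
        convert (hm1 p.1).inter (hm2 p.2) using 1
        ext z; simp [Prod.ext_iff]) (fun p => x p.1 * x p.2), Fintype.sum_prod_type] at h
    refine h.trans_eq ?_
    simp only [dotProduct, Matrix.mulVec, Finset.mul_sum, Matrix.of_apply, star_trivial]
    refine Finset.sum_congr rfl fun a _ => Finset.sum_congr rfl fun b _ => ?_
    rw [measureReal_restrict_apply' hm3]
    have : {z : ι → V | u (fun s => z (e (.inl s))) = a ∧
        u (fun s => z (e (.inr (.inl s)))) = b ∧ (fun s => z (e (.inr (.inr s)))) ∈ T} =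
        (fun z : ι → V => (u fun s => z (e (.inl s)), u fun s => z (e (.inr (.inl s))))) ⁻¹'
          {(a, b)} ∩ {z | (fun s => z (e (.inr (.inr s)))) ∈ T} := by
      ext z; simp [and_assoc]
    rw [this]
    ring

/-- **Schur product theorem** for two matrices glued along a common index. -/
lemma sum_glue_nonneg {I J A : Type*} [Fintype I] [Fintype J] [Fintype A]
    {M : Matrix (I × A) (I × A) ℝ} {N : Matrix (J × A) (J × A) ℝ} (hM : M.PosSemidef)
    (hN : N.PosSemidef) (x : I × J × A → ℝ) :
    0 ≤ ∑ p : (I × J × A) × (I × J × A), x p.1 * x p.2 *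
      (M (p.1.1, p.1.2.2) (p.2.1, p.2.2.2) * N (p.1.2.1, p.1.2.2) (p.2.2.1, p.2.2.2)) := by
  have h := ((hM.submatrix fun q : I × J × A => (q.1, q.2.2)).hadamard
    (hN.submatrix fun q : I × J × A => (q.2.1, q.2.2))).dotProduct_mulVec_nonneg x
  rw [Fintype.sum_prod_type]
  refine h.trans_eq ?_
  simp only [dotProduct, Matrix.mulVec, Finset.mul_sum, Matrix.hadamard_apply,
    Matrix.submatrix_apply, star_trivial]
  exact Finset.sum_congr rfl fun a _ => Finset.sum_congr rfl fun b _ => by ring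

variable {X Y Z : Type*} [MeasurableSpace X] [MeasurableSpace Y] [MeasurableSpace Z]

/-- The sets of families whose three blocks have prescribed values under two classifications. -/
def blockSet (e : κ ⊕ κ ⊕ τ ≃ ι) {I K : Type*} (c : (κ → X) → I) (d : (τ → X) → K)
    (p : I × I × K) : Set (ι → X) :=
  {x | c (fun s => x (e (.inl s))) = p.1 ∧ c (fun s => x (e (.inr (.inl s)))) = p.2.1 ∧
    d (fun s => x (e (.inr (.inr s)))) = p.2.2}

lemma measurableSet_blockSet (e : κ ⊕ κ ⊕ τ ≃ ι) {I K : Type*} {c : (κ → X) → I} {d : (τ → X) → K}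
    (hc : ∀ a, MeasurableSet (c ⁻¹' {a})) (hd : ∀ a, MeasurableSet (d ⁻¹' {a})) (p : I × I × K) :
    MeasurableSet (blockSet e c d p) :=
  (measurable_block_s9 (fun s => e (.inl s)) (hc _)).inter
    ((measurable_block_s9 (fun s => e (.inr (.inl s))) (hc _)).inter
      (measurable_block_s9 (fun s => e (.inr (.inr s))) (hd _)))

/-- Families indexed by three blocks. -/
def blockEquiv (e : κ ⊕ κ ⊕ τ ≃ ι) (D : Type*) : (κ → D) × (κ → D) × (τ → D) ≃ (ι → D) :=
  (((Equiv.refl _).prodCongr (Equiv.sumArrowEquivProdArrow κ τ D).symm).trans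
    (Equiv.sumArrowEquivProdArrow κ (κ ⊕ τ) D).symm).trans (e.arrowCongr (Equiv.refl D))

lemma blockEquiv_apply (e : κ ⊕ κ ⊕ τ ≃ ι) {D : Type*} (a : (κ → D) × (κ → D) × (τ → D))
    (q : κ ⊕ κ ⊕ τ) :
    blockEquiv e D a (e q) = Sum.elim a.1 (Sum.elim a.2.1 a.2.2) q := by
  simp [blockEquiv, Equiv.arrowCongr, Equiv.sumArrowEquivProdArrow]

variable [MeasurableSpace.CountablyGenerated Y]

/-- The matrix entries of discretized measures are masses of rectangles. -/
lemma jointMass_blockSet_cell (e : κ ⊕ κ ⊕ τ ≃ ι) {I K : Type*} (c : (κ → X) → I)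
    (d : (τ → X) → K) (P : Measure (ι → X × Y)) (p : I × I × K) (l : ℕ)
    (a : (κ → Fin l → Bool) × (κ → Fin l → Bool) × (τ → Fin l → Bool)) :
    jointMass P (blockSet e c d p) (cell l (blockEquiv e _ a)) =
      P.real {z | (fun w : κ → X × Y => (c fun s => (w s).1, fun s => code Y l (w s).2))
          (fun s => z (e (.inl s))) = (p.1, a.1) ∧
        (fun w : κ → X × Y => (c fun s => (w s).1, fun s => code Y l (w s).2))
          (fun s => z (e (.inr (.inl s)))) = (p.2.1, a.2.1) ∧
        (fun s => z (e (.inr (.inr s)))) ∈ {w : τ → X × Y | (fun s => (w s).1) ∈ d ⁻¹' {p.2.2} ∧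
          (fun s => (w s).2) ∈ cell l a.2.2}} := by
  rw [jointMass]
  congr 1
  ext z
  have : (fun s => (z s).2) ∈ cell l (blockEquiv e _ a) ↔
      (fun s => code Y l (z (e (.inl s))).2) = a.1 ∧
      (fun s => code Y l (z (e (.inr (.inl s)))).2) = a.2.1 ∧
      (fun s => (z (e (.inr (.inr s)))).2) ∈ cell l a.2.2 := by
    rw [mem_cell, ← e.forall_congr_right]
    simp [blockEquiv_apply, Sum.forall, funext_iff, mem_cell]
  simp only [mem_ofPred_eq, this, blockSet, Prod.mk.injEq, mem_preimage, mem_singleton_iff]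
  tauto

lemma measurableSet_classify_preimage [Fintype κ] {I : Type*} {c : (κ → X) → I}
    (hc : ∀ a, MeasurableSet (c ⁻¹' {a})) {l : ℕ} (b : I × (κ → Fin l → Bool)) :
    MeasurableSet ((fun w : κ → X × Y => (c fun s => (w s).1, fun s => code Y l (w s).2)) ⁻¹'
      {b}) := by
  convert measurableSet_joint (hc b.1) (measurableSet_cell (Y := Y) l b.2) using 1
  ext w
  simp [Prod.ext_iff, mem_cell, funext_iff]

variable [Fintype ι] [DecidableEq ι] [Fintype κ] [DecidableEq κ] [Fintype τ] [DecidableEq τ]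

/-- Positivity of the discretized composition. -/
lemma sum_cell_nonneg {e : κ ⊕ κ ⊕ τ ≃ ι} {ν : Measure Y} [IsFiniteMeasure ν]
    {P : Measure (ι → X × Y)} {Q : Measure (ι → Z × Y)} [IsFiniteMeasure P] [IsFiniteMeasure Q]
    (hP : PSDOn e P) (hPs : ∀ σ : Equiv.Perm ι, P.map (fun z => z ∘ σ) = P)
    (hQ : PSDOn e Q) (hQs : ∀ σ : Equiv.Perm ι, Q.map (fun z => z ∘ σ) = Q)
    {I J K L : Type*} [Fintype I] [Fintype J] [Fintype K] [Fintype L]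
    {cX : (κ → X) → I} {dX : (τ → X) → K} {cZ : (κ → Z) → J} {dZ : (τ → Z) → L}
    (hcX : ∀ a, MeasurableSet (cX ⁻¹' {a})) (hdX : ∀ a, MeasurableSet (dX ⁻¹' {a}))
    (hcZ : ∀ a, MeasurableSet (cZ ⁻¹' {a})) (hdZ : ∀ a, MeasurableSet (dZ ⁻¹' {a}))
    (F : I × J → ℝ) {G : K × L → ℝ} (hG : ∀ b, 0 ≤ G b) (l : ℕ) :
    0 ≤ ∑ q : (I × J) × (I × J) × (K × L), (∑ a : ι → Fin l → Bool,
      jointMass P (blockSet e cX dX (q.1.1, q.2.1.1, q.2.2.1)) (cell l a) *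
      jointMass Q (blockSet e cZ dZ (q.1.2, q.2.1.2, q.2.2.2)) (cell l a) /
        ∏ s, ν.real (code Y l ⁻¹' {a s})) * (F q.1 * F q.2.1 * G q.2.2) := by
  let D := Fin l → Bool
  let m : D → ℝ := fun b => ν.real (code Y l ⁻¹' {b})
  let reorder : ((I × J) × (I × J) × (K × L)) × ((κ → D) × (κ → D) × (τ → D)) ≃
      ((K × L) × (τ → D)) × ((I × J × (κ → D)) × (I × J × (κ → D))) :=
    { toFun := fun p => ((p.1.2.2, p.2.2.2), (p.1.1.1, p.1.1.2, p.2.1),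
        (p.1.2.1.1, p.1.2.1.2, p.2.2.1))
      invFun := fun p => (((p.2.1.1, p.2.1.2.1), (p.2.2.1, p.2.2.2.1), p.1.1),
        (p.2.1.2.2, p.2.2.2.2, p.1.2))
      left_inv := fun _ => rfl
      right_inv := fun _ => rfl }
  let MX (k : K) (a : τ → D) : Matrix (I × (κ → D)) (I × (κ → D)) ℝ := Matrix.of fun u v =>
    jointMass P (blockSet e cX dX (u.1, v.1, k)) (cell l (blockEquiv e _ (u.2, v.2, a)))
  let MZ (k : L) (a : τ → D) : Matrix (J × (κ → D)) (J × (κ → D)) ℝ := Matrix.of fun u v =>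
    jointMass Q (blockSet e cZ dZ (u.1, v.1, k)) (cell l (blockEquiv e _ (u.2, v.2, a)))
  have hMX (k : K) (a : τ → D) : (MX k a).PosSemidef := by
    convert posSemidef_of_psdOn hP hPs (measurableSet_classify_preimage hcX)
      (measurableSet_joint (hdX k) (measurableSet_cell (Y := Y) l a)) using 1
    ext u v
    exact jointMass_blockSet_cell e cX dX P (u.1, v.1, k) l (u.2, v.2, a)
  have hMZ (k : L) (a : τ → D) : (MZ k a).PosSemidef := by
    convert posSemidef_of_psdOn hQ hQs (measurableSet_classify_preimage hcZ)
      (measurableSet_joint (hdZ k) (measurableSet_cell (Y := Y) l a)) using 1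
    ext u v
    exact jointMass_blockSet_cell e cZ dZ Q (u.1, v.1, k) l (u.2, v.2, a)
  have hprod (a : (κ → D) × (κ → D) × (τ → D)) : ∏ s, m (blockEquiv e D a s) =
      (∏ s, m (a.1 s)) * ((∏ s, m (a.2.1 s)) * ∏ s, m (a.2.2 s)) := by
    rw [← e.prod_comp, Fintype.prod_sum_type, Fintype.prod_sum_type]
    simp only [blockEquiv_apply, Sum.elim_inl, Sum.elim_inr]
  let x (u : I × J × (κ → D)) : ℝ := F (u.1, u.2.1) * (∏ s, m (u.2.2 s))⁻¹
  have hsum : ∑ q : (I × J) × (I × J) × (K × L), (∑ a : ι → Fin l → Bool,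
      jointMass P (blockSet e cX dX (q.1.1, q.2.1.1, q.2.2.1)) (cell l a) *
      jointMass Q (blockSet e cZ dZ (q.1.2, q.2.1.2, q.2.2.2)) (cell l a) /
        ∏ s, ν.real (code Y l ⁻¹' {a s})) * (F q.1 * F q.2.1 * G q.2.2) =
      ∑ b : (K × L) × (τ → D), G b.1 * (∏ s, m (b.2 s))⁻¹ *
        ∑ p : (I × J × (κ → D)) × (I × J × (κ → D)), x p.1 * x p.2 *
          (MX b.1.1 b.2 (p.1.1, p.1.2.2) (p.2.1, p.2.2.2) *
            MZ b.1.2 b.2 (p.1.2.1, p.1.2.2) (p.2.2.1, p.2.2.2)) := by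
    simp only [Finset.mul_sum, Finset.sum_mul]
    conv_rhs => rw [← Fintype.sum_prod_type', ← reorder.sum_comp, Fintype.sum_prod_type]
    refine Finset.sum_congr rfl fun q _ => ?_
    rw [← (blockEquiv e D).sum_comp]
    refine Finset.sum_congr rfl fun a _ => ?_
    change _ / (∏ s, m (blockEquiv e D a s)) * _ = _
    rw [hprod]
    simp only [reorder, x, MX, MZ, Equiv.coe_fn_mk, Matrix.of_apply, div_eq_mul_inv, mul_inv]
    ring
  rw [hsum]
  refine Finset.sum_nonneg fun b _ => mul_nonneg (mul_nonneg (hG _) ?_) ?_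
  · exact inv_nonneg.2 (Finset.prod_nonneg fun _ _ => measureReal_nonneg)
  · exact sum_glue_nonneg (hMX b.1.1 b.2) (hMZ b.1.2 b.2) x

end PSD

section GluePSD

variable {ι κ τ : Type*} [Fintype ι] [DecidableEq ι] [Fintype κ] [DecidableEq κ] [Fintype τ]
  [DecidableEq τ] {X Y Z : Type*} [MeasurableSpace X] [MeasurableSpace Y] [MeasurableSpace Z]
  [MeasurableSpace.CountablyGenerated Y] {e : κ ⊕ κ ⊕ τ ≃ ι} {ν : Measure Y} [IsFiniteMeasure ν]
  {P : Measure (ι → X × Y)} {Q : Measure (ι → Z × Y)} {R : Measure (ι → X × Z)}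
  [IsFiniteMeasure P] [IsFiniteMeasure Q] [IsFiniteMeasure R]

/-- Positivity of the composition against functions of finitely many classes. -/
lemma IsGlue.integral_class_nonneg (h : IsGlue ν P Q R)
    (hP : PSDOn e P) (hPs : ∀ σ : Equiv.Perm ι, P.map (fun z => z ∘ σ) = P)
    (hQ : PSDOn e Q) (hQs : ∀ σ : Equiv.Perm ι, Q.map (fun z => z ∘ σ) = Q)
    {I J K L : Type*} [Finite I] [Finite J] [Finite K] [Finite L]
    {cX : (κ → X) → I} {dX : (τ → X) → K} {cZ : (κ → Z) → J} {dZ : (τ → Z) → L}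
    (hcX : ∀ a, MeasurableSet (cX ⁻¹' {a})) (hdX : ∀ a, MeasurableSet (dX ⁻¹' {a}))
    (hcZ : ∀ a, MeasurableSet (cZ ⁻¹' {a})) (hdZ : ∀ a, MeasurableSet (dZ ⁻¹' {a}))
    (F : I × J → ℝ) {G : K × L → ℝ} (hG : ∀ b, 0 ≤ G b) :
    0 ≤ ∫ z, F (cX fun s => (z (e (.inl s))).1, cZ fun s => (z (e (.inl s))).2) *
      F (cX fun s => (z (e (.inr (.inl s)))).1, cZ fun s => (z (e (.inr (.inl s)))).2) *
      G (dX fun s => (z (e (.inr (.inr s)))).1, dZ fun s => (z (e (.inr (.inr s)))).2) ∂(R) := by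
  have := Fintype.ofFinite I
  have := Fintype.ofFinite J
  have := Fintype.ofFinite K
  have := Fintype.ofFinite L
  let c (z : ι → X × Z) : (I × J) × (I × J) × (K × L) :=
    ((cX fun s => (z (e (.inl s))).1, cZ fun s => (z (e (.inl s))).2),
      (cX fun s => (z (e (.inr (.inl s)))).1, cZ fun s => (z (e (.inr (.inl s)))).2),
      (dX fun s => (z (e (.inr (.inr s)))).1, dZ fun s => (z (e (.inr (.inr s)))).2))
  have hc (q) : c ⁻¹' {q} = {z | (fun s => (z s).1) ∈ blockSet e cX dX (q.1.1, q.2.1.1, q.2.2.1) ∧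
      (fun s => (z s).2) ∈ blockSet e cZ dZ (q.1.2, q.2.1.2, q.2.2.2)} := by
    ext z
    simp only [c, blockSet, mem_preimage, mem_singleton_iff, Prod.ext_iff, mem_ofPred_eq]
    tauto
  have hmX (p) := measurableSet_blockSet e hcX hdX p
  have hmZ (p) := measurableSet_blockSet e hcZ hdZ p
  have heq := integral_comp_eq_sum (μ := R) (c := c)
    (fun q => by rw [hc]; exact measurableSet_joint (hmX _) (hmZ _))
    (fun q => F q.1 * F q.2.1 * G q.2.2)
  refine le_of_le_of_eq ?_ heq.symm
  simp only [hc]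
  exact ge_of_tendsto' (tendsto_finsetSum _ fun q _ => (h _ _ (hmX _) (hmZ _)).mul_const _)
    fun l => sum_cell_nonneg hP hPs hQ hQs hcX hdX hcZ hdZ F hG l

/-- Positivity passes to the composition. -/
lemma IsGlue.psdOn [MeasurableSpace.CountablyGenerated X] [MeasurableSpace.CountablyGenerated Z]
    (h : IsGlue ν P Q R)
    (hP : PSDOn e P) (hPs : ∀ σ : Equiv.Perm ι, P.map (fun z => z ∘ σ) = P)
    (hQ : PSDOn e Q) (hQs : ∀ σ : Equiv.Perm ι, Q.map (fun z => z ∘ σ) = Q) : PSDOn e R := by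
  intro f g hf ⟨M, hfM⟩ hg ⟨N, hgN⟩ hg0
  let F' (p : (κ → X) × (κ → Z)) : ℝ := f fun s => (p.1 s, p.2 s)
  let G' (p : (τ → X) × (τ → Z)) : ℝ := g fun s => (p.1 s, p.2 s)
  have hF' : Measurable F' := hf.comp (by fun_prop)
  have hG' : Measurable G' := hg.comp (by fun_prop)
  let u₁ (z : ι → X × Z) : (κ → X) × (κ → Z) :=
    (fun s => (z (e (.inl s))).1, fun s => (z (e (.inl s))).2)
  let u₂ (z : ι → X × Z) : (κ → X) × (κ → Z) :=
    (fun s => (z (e (.inr (.inl s)))).1, fun s => (z (e (.inr (.inl s)))).2)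
  let u₃ (z : ι → X × Z) : (τ → X) × (τ → Z) :=
    (fun s => (z (e (.inr (.inr s)))).1, fun s => (z (e (.inr (.inr s)))).2)
  have hu₁ : Measurable u₁ := by fun_prop
  have hu₂ : Measurable u₂ := by fun_prop
  have hu₃ : Measurable u₃ := by fun_prop
  let c (n : ℕ) (p : (κ → X) × (κ → Z)) := (fun s => code X n (p.1 s), fun s => code Z n (p.2 s))
  let d (n : ℕ) (p : (τ → X) × (τ → Z)) := (fun s => code X n (p.1 s), fun s => code Z n (p.2 s))
  have hc : IsCode c := ((isCode_code X).pi κ).prod ((isCode_code Z).pi κ)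
  have hd : IsCode d := ((isCode_code X).pi τ).prod ((isCode_code Z).pi τ)
  let m := R.map u₁ + R.map u₂
  let F (n : ℕ) := cellAvg m (c n) F'
  let G (n : ℕ) := cellAvg (R.map u₃) (d n) G'
  have hF : ∀ᵐ p ∂m, Tendsto (fun n => F n (c n p)) atTop (𝓝 (F' p)) :=
    hc.tendsto_cellAvg hF' (.of_bound hF'.aestronglyMeasurable M (.of_forall fun p => hfM _))
  have hG : ∀ᵐ p ∂(R.map u₃), Tendsto (fun n => G n (d n p)) atTop (𝓝 (G' p)) :=
    hd.tendsto_cellAvg hG' (.of_bound hG'.aestronglyMeasurable N (.of_forall fun p => hgN _))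
  rw [ae_add_measure_iff] at hF
  have hF₁ := ae_of_ae_map hu₁.aemeasurable hF.1
  have hF₂ := ae_of_ae_map hu₂.aemeasurable hF.2
  have hG₃ := ae_of_ae_map hu₃.aemeasurable hG
  have hFb (n a) : |F n a| ≤ |M| :=
    abs_cellAvg_le (abs_nonneg M) (fun p => (hfM _).trans (le_abs_self M)) a
  have hGb (n a) : |G n a| ≤ |N| :=
    abs_cellAvg_le (abs_nonneg N) (fun p => (hgN _).trans (le_abs_self N)) a
  have hlim : Tendsto (fun n => ∫ z, F n (c n (u₁ z)) * F n (c n (u₂ z)) * G n (d n (u₃ z)) ∂(R))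
      atTop (𝓝 (∫ z, F' (u₁ z) * F' (u₂ z) * G' (u₃ z) ∂(R))) := by
    refine tendsto_integral_of_dominated_convergence (fun _ => |M| * |M| * |N|) (fun n => ?_)
      (integrable_const _) (fun n => .of_forall fun z => ?_) ?_
    · exact ((((hc.measurable_comp n (F n)).comp hu₁).mul
        ((hc.measurable_comp n (F n)).comp hu₂)).mul
        ((hd.measurable_comp n (G n)).comp hu₃)).aestronglyMeasurable
    · rw [Real.norm_eq_abs, abs_mul, abs_mul]
      exact mul_le_mul (mul_le_mul (hFb _ _) (hFb _ _) (abs_nonneg _) (abs_nonneg _)) (hGb _ _)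
        (abs_nonneg _) (by positivity)
    · filter_upwards [hF₁, hF₂, hG₃] with z h₁ h₂ h₃ using (h₁.mul h₂).mul h₃
  refine ge_of_tendsto' hlim fun n => ?_
  exact h.integral_class_nonneg hP hPs hQ hQs
    (fun a => ((isCode_code X).pi κ).measurableSet_preimage n {a})
    (fun a => ((isCode_code X).pi τ).measurableSet_preimage n {a})
    (fun a => ((isCode_code Z).pi κ).measurableSet_preimage n {a})
    (fun a => ((isCode_code Z).pi τ).measurableSet_preimage n {a}) (F n)
    (fun b => cellAvg_nonneg (fun p => hg0 _) b)

end GluePSD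

section PiR

/-- The splitting of `2 * r` coordinates into two blocks of size `t` and a rest. -/
def splitEquiv {r t : ℕ} (ht : t ≤ r) : Fin t ⊕ Fin t ⊕ Fin (2 * r - 2 * t) ≃ Fin (2 * r) :=
  (((Equiv.refl _).sumCongr finSumFinEquiv).trans finSumFinEquiv).trans (finCongr (by omega))

lemma psdOn_splitEquiv_iff {V W : Type*} [MeasurableSpace V] [MeasurableSpace W] {r : ℕ}
    {P : Measure (Fin (2 * r) → V × W)} :
    PSDCond r P ↔ ∀ t (ht : t ≤ r), PSDOn (splitEquiv ht) P := by
  refine forall₂_congr fun t ht => ?_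
  have h₁ (s : Fin t) : splitEquiv ht (.inl s) = ⟨s.1, by have := s.isLt; omega⟩ := by
    ext; simp [splitEquiv]
  have h₂ (s : Fin t) : splitEquiv ht (.inr (.inl s)) = ⟨t + s.1, by have := s.isLt; omega⟩ := by
    ext; simp [splitEquiv]
  have h₃ (s : Fin (2 * r - 2 * t)) : splitEquiv ht (.inr (.inr s)) =
      ⟨2 * t + s.1, by have := s.isLt; omega⟩ := by
    ext; simp [splitEquiv]; omega
  simp only [PSDOn, h₁, h₂, h₃]

variable {ι κ τ V W E : Type*} [MeasurableSpace V] [MeasurableSpace W] [MeasurableSpace E]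

lemma PSDOn.map {e : κ ⊕ κ ⊕ τ ≃ ι} {P : Measure (ι → V)} (h : PSDOn e P) {φ : V → W}
    (hφ : Measurable φ) : PSDOn e (P.map fun w s => φ (w s)) := by
  intro f g hf ⟨M, hM⟩ hg ⟨N, hN⟩ hg0
  have hm : Measurable fun (w : ι → V) s => φ (w s) := by fun_prop
  rw [integral_map hm.aemeasurable (by fun_prop)]
  exact h (fun w => f fun s => φ (w s)) (fun w => g fun s => φ (w s)) (by fun_prop)
    ⟨M, fun _ => hM _⟩ (by fun_prop) ⟨N, fun _ => hN _⟩ fun _ => hg0 _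

lemma map_perm_map {P : Measure (ι → V)} {σ : Equiv.Perm ι} (h : P.map (fun z => z ∘ σ) = P)
    {φ : V → W} (hφ : Measurable φ) :
    (P.map fun w s => φ (w s)).map (fun z => z ∘ σ) = P.map fun w s => φ (w s) := by
  conv_rhs => rw [← h]
  rw [Measure.map_map (measurable_comp_perm σ) (by fun_prop),
    Measure.map_map (by fun_prop) (measurable_comp_perm σ)]
  rfl

lemma CoordIndep.map {P : Measure (ι → V)} [IsFiniteMeasure P] {i : ι} {φ : V → W} {ψ : W → E}
    {μ : Measure E} [SFinite μ] (h : CoordIndep P i (fun v => ψ (φ v)) μ) (hφ : Measurable φ)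
    (hψ : Measurable ψ) : CoordIndep (P.map fun w s => φ (w s)) i ψ μ := by
  have hm : Measurable fun (z : {j : ι // j ≠ i} → V) s => φ (z s) := by fun_prop
  have := congrArg (Measure.map (Prod.map id fun (z : {j : ι // j ≠ i} → V) s => φ (z s))) h
  rw [Measure.map_map (by fun_prop) (by fun_prop), ← Measure.map_prod_map _ _ measurable_id hm,
    Measure.map_id, Measure.map_map hm (by fun_prop)] at this
  rw [CoordIndep, Measure.map_map (by fun_prop) (by fun_prop),
    Measure.map_map (by fun_prop) (by fun_prop)]
  exact this

end PiR

end

theorem stmt9 {X Y Z : Type*}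
    [MetricSpace X] [CompactSpace X] [PolishSpace X] [MeasurableSpace X] [BorelSpace X]
    [MetricSpace Y] [CompactSpace Y] [PolishSpace Y] [MeasurableSpace Y] [BorelSpace Y]
    [MetricSpace Z] [CompactSpace Z] [PolishSpace Z] [MeasurableSpace Z] [BorelSpace Z]
    (hdX : Metric.diam (Set.univ : Set X) ≤ 1) (hdY : Metric.diam (Set.univ : Set Y) ≤ 1)
    (hdZ : Metric.diam (Set.univ : Set Z) ≤ 1)
    (μ : Measure X) (ν : Measure Y) (κ : Measure Z)
    [IsProbabilityMeasure μ] [IsProbabilityMeasure ν] [IsProbabilityMeasure κ]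
    (r : ℕ) (hr : 0 < r)
    (P : Measure (Fin (2 * r) → X × Y)) (hP : P ∈ PiRSet r μ ν)
    (Q : Measure (Fin (2 * r) → Y × Z)) (hQ : Q ∈ PiRSet r ν κ) :
    ∃ S : Measure (Fin (2 * r) → X × Y × Z), IsProbabilityMeasure S ∧
      S.map (fun z (s : Fin (2 * r)) => ((z s).1, (z s).2.1)) = P ∧
      S.map (fun z (s : Fin (2 * r)) => ((z s).2.1, (z s).2.2)) = Q ∧
      S.map (fun z (s : Fin (2 * r)) => ((z s).1, (z s).2.2)) ∈ PiRSet r μ κ := by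
  obtain ⟨hP1, hPs, hPm, hPp⟩ := hP
  obtain ⟨hQ1, hQs, hQm, hQp⟩ := hQ
  obtain ⟨S, hS, hSP, hSQ, hR⟩ := exists_isGlue ν P Q
    (map_eq_pi_of_coordIndep measurable_snd fun i => (hPm i).2)
    (map_eq_pi_of_coordIndep measurable_fst fun i => (hQm i).1)
  have := Measure.isProbabilityMeasure_map (μ := Q) (f := fun w s => (w s).swap)
        (Measurable.aemeasurable (by fun_prop))
  have hR1 := Measure.isProbabilityMeasure_map (μ := S)
    (f := fun z (s : Fin (2 * r)) => ((z s).1, (z s).2.2)) (by fun_prop)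
  have hQs' (σ : Equiv.Perm (Fin (2 * r))) := map_perm_map (hQs σ) measurable_swap
  refine ⟨S, hS, hSP, hSQ, hR1, fun σ => hR.map_perm σ (hPs σ) (hQs' σ), fun i => ⟨?_, ?_⟩, ?_⟩
  · exact hR.coordIndep_fst i (hPm i).1 (hPm i).2
      (CoordIndep.map (hQm i).1 measurable_swap measurable_snd)
  · have := Measure.isProbabilityMeasure_map (f := fun w s => (w s).swap)
      (μ := S.map fun z s => ((z s).1, (z s).2.2)) (Measurable.aemeasurable (by fun_prop))
    have h := hR.swap.coordIndep_fst i
      (CoordIndep.map (hQm i).2 measurable_swap measurable_fst)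
      (CoordIndep.map (hQm i).1 measurable_swap measurable_snd) (hPm i).2
    have h' := CoordIndep.map (φ := Prod.swap) (ψ := Prod.snd) h measurable_swap measurable_snd
    rw [Measure.map_map (by fun_prop) (by fun_prop)] at h'
    simp only [Function.comp_def, Prod.swap_swap, Measure.map_id'] at h'
    exact h'
  · rw [psdOn_splitEquiv_iff] at hPp hQp ⊢
    exact fun t ht => hR.psdOn (hPp t ht) hPs ((hQp t ht).map measurable_swap) hQs'

end GWSOS
end
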